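/- arXiv:1003.4605 — 3 statements merged into one kernel-verified Lean document; each statement's English description precedes it below -/
import Mathlib

section
/- Let f be a nonzero psd element of ℝ[C]. Then there exist an integer r ≥ 0 and nonzero elements g₁, …, g_r of ℝ[C] such that, setting h = f − (g₁² + ⋯ + g_r²): (a) h is psd (nonnegative on C(ℝ)); (b) h = 0, or every zero of h on C(ℂ) is real; (c) δ(g_i) ≤ ⌈δ(f)/2⌉ for i = 1, …, r, and δ(h) ≤ δ(f) if h ≠ 0. -/
open Polynomial

noncomputable section

/-- The defining polynomial `y² + q(x)` of the curve, as a polynomial in `y`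
over `ℝ[x]`. -/
def curvePoly (q : Polynomial ℝ) : Polynomial (Polynomial ℝ) :=
  X ^ 2 + C q

lemma curvePoly_monic (q : Polynomial ℝ) : (curvePoly q).Monic :=
  Polynomial.monic_X_pow_add_C q (by norm_num)

/-- The coordinate ring `ℝ[C] = ℝ[x,y]/(y² + q(x))`. -/
abbrev CurveRing (q : Polynomial ℝ) : Type := AdjoinRoot (curvePoly q)

/-- The unique representative `a(x) + b(x)·y` (of `y`-degree `< 2`) of an element. -/
def curveRep (q : Polynomial ℝ) (f : CurveRing q) : Polynomial (Polynomial ℝ) :=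
  AdjoinRoot.modByMonicHom (curvePoly_monic q) f

/-- The polynomial `a(x)` with `f = a(x) + b(x)·y`. -/
def repA (q : Polynomial ℝ) (f : CurveRing q) : Polynomial ℝ := (curveRep q f).coeff 0

/-- The polynomial `b(x)` with `f = a(x) + b(x)·y`. -/
def repB (q : Polynomial ℝ) (f : CurveRing q) : Polynomial ℝ := (curveRep q f).coeff 1

/-- `δ(f) = max (deg a, 2 + deg b)` for `f = a(x) + b(x)·y ≠ 0`. -/
def curveDelta (q : Polynomial ℝ) (f : CurveRing q) : ℕ :=
  if repB q f = 0 then (repA q f).natDegree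
  else max (repA q f).natDegree (2 + (repB q f).natDegree)

/-- `f ∈ ℝ[C]` is psd: nonnegative at all real points of the curve. -/
def IsPsd (q : Polynomial ℝ) (f : CurveRing q) : Prop :=
  ∀ u v : ℝ, v ^ 2 + q.eval u = 0 → 0 ≤ (repA q f).eval u + (repB q f).eval u * v

/-- `f` is a sum of squares of elements of `δ`-degree at most `d`. -/
def IsSosLe (q : Polynomial ℝ) (f : CurveRing q) (d : ℕ) : Prop :=
  ∃ (r : ℕ) (g : Fin r → CurveRing q), f = ∑ i, g i ^ 2 ∧ ∀ i, curveDelta q (g i) ≤ d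

/-- `θ(f)`: the least `d` such that `f` is a sum of squares of elements of
`δ`-degree `≤ d`, and `∞` if `f` is not a sum of squares. -/
def curveTheta (q : Polynomial ℝ) (f : CurveRing q) : ℕ∞ :=
  sInf {d : ℕ∞ | ∃ n : ℕ, d = (n : ℕ∞) ∧ IsSosLe q f n}

/-- All zeros of `f` on `C(ℂ)` are real. -/
def AllZerosReal (q : Polynomial ℝ) (f : CurveRing q) : Prop :=
  ∀ u v : ℂ, v ^ 2 + (q.map (algebraMap ℝ ℂ)).eval u = 0 →
    ((repA q f).map (algebraMap ℝ ℂ)).eval u +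
      ((repB q f).map (algebraMap ℝ ℂ)).eval u * v = 0 →
    u.im = 0 ∧ v.im = 0

/-- The monic polynomial `∏ (X - a)` over a multiset `s` of real numbers. -/
def linProd (s : Multiset ℝ) : ℝ[X] := (s.map fun a => X - C a).prod

lemma linProd_cons (a : ℝ) (s : Multiset ℝ) : linProd (a ::ₘ s) = (X - C a) * linProd s := by
  simp [linProd]

lemma linProd_add (s t : Multiset ℝ) : linProd (s + t) = linProd s * linProd t := by
  simp [linProd]

lemma linProd_monic (s : Multiset ℝ) : (linProd s).Monic :=
  monic_multiset_prod_of_monic _ _ fun a _ => monic_X_sub_C a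

lemma linProd_natDegree (s : Multiset ℝ) : (linProd s).natDegree = Multiset.card s :=
  natDegree_multiset_prod_X_sub_C_eq_card s

lemma aeval_linProd_eq_zero {s : Multiset ℝ} {u : ℂ}
    (h : ((linProd s).map (algebraMap ℝ ℂ)).eval u = 0) : ∃ a ∈ s, u = (a : ℂ) := by
  induction s using Multiset.induction_on with
  | empty => simp [linProd] at h
  | cons a s ih =>
    rw [linProd_cons, Polynomial.map_mul, eval_mul, mul_eq_zero] at h
    rcases h with h | h
    · refine ⟨a, by simp, ?_⟩
      simpa [sub_eq_zero] using h
    · obtain ⟨b, hb, hu⟩ := ih h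
      exact ⟨b, by simp [hb], hu⟩

lemma eval_linProd_eq_zero {s : Multiset ℝ} {u : ℝ} (h : (linProd s).eval u = 0) : u ∈ s := by
  induction s using Multiset.induction_on with
  | empty => simp [linProd] at h
  | cons a s ih =>
    rw [linProd_cons, eval_mul, mul_eq_zero] at h
    rcases h with h | h
    · simp only [eval_sub, eval_X, eval_C, sub_eq_zero] at h
      simp [h]
    · simp [ih h]

lemma Multiset.exists_eq_add_self_add_nodup (s : Multiset ℝ) :
    ∃ e f : Multiset ℝ, f.Nodup ∧ s = e + e + f := by
  classical
  induction s using Multiset.induction_on with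
  | empty => exact ⟨0, 0, by simp, by simp⟩
  | cons a s ih =>
    obtain ⟨e, f, hf, rfl⟩ := ih
    by_cases ha : a ∈ f
    · refine ⟨a ::ₘ e, f.erase a, hf.erase a, ?_⟩
      conv_lhs => rw [← Multiset.cons_erase ha]
      simp only [← Multiset.singleton_add]
      abel
    · refine ⟨e, a ::ₘ f, Multiset.nodup_cons.2 ⟨ha, hf⟩, ?_⟩
      simp only [← Multiset.singleton_add]
      abel

/-- Every nonzero real polynomial is a square times a squarefree product of linear factors,
both with roots in `S`, times a polynomial without roots in `S`. -/
lemma exists_factorization_on (S : Set ℝ) {D : ℝ[X]} (hD : D ≠ 0) :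
    ∃ (e f : Multiset ℝ) (R : ℝ[X]), f.Nodup ∧ (∀ a ∈ e, a ∈ S) ∧ (∀ a ∈ f, a ∈ S) ∧
      (∀ x ∈ S, R.eval x ≠ 0) ∧ D = linProd e ^ 2 * linProd f * R := by
  classical
  obtain ⟨R, hR, -, hR0⟩ := exists_prod_multiset_X_sub_C_mul D
  obtain ⟨e, f, hf, hef⟩ := Multiset.exists_eq_add_self_add_nodup (D.roots.filter (· ∈ S))
  have hmem : ∀ a, a ∈ e + e + f → a ∈ S := by
    intro a ha
    rw [← hef] at ha
    exact (Multiset.mem_filter.1 ha).2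
  refine ⟨e, f, linProd (D.roots.filter (· ∉ S)) * R, hf, fun a ha => hmem a (by simp [ha]),
    fun a ha => hmem a (by simp [ha]), ?_, ?_⟩
  · intro x hx h
    rw [eval_mul, mul_eq_zero] at h
    rcases h with h | h
    · exact (Multiset.mem_filter.1 (eval_linProd_eq_zero h)).2 hx
    · have hRne : R ≠ 0 := by
        rintro rfl
        simp at hR
        exact hD hR.symm
      have : x ∈ R.roots := (mem_roots hRne).2 h
      simp [hR0] at this
  · conv_lhs => rw [← hR]
    change linProd D.roots * R = _
    rw [← Multiset.filter_add_not (· ∈ S) D.roots, hef]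
    simp only [linProd_add]
    rw [← hef, Multiset.filter_add_not]
    ring

lemma eval_eq_zero_of_sign_change {E : ℝ[X]} (hE : E ≠ 0) {φ : ℝ → ℝ} {u : ℝ}
    (hφ : ContinuousAt φ u)
    (h : ∀ᶠ x in nhds u, 0 ≤ (x - u) * φ x * E.eval x ^ 2) : φ u = 0 := by
  have hE' : ∀ᶠ x in nhdsWithin u {u}ᶜ, E.eval x ≠ 0 := by
    have hfin : (E.rootSet ℝ \ {u}).Finite := (E.rootSet_finite ℝ).subset Set.sdiff_subset
    have : (E.rootSet ℝ \ {u})ᶜ ∈ nhds u := hfin.isClosed.isOpen_compl.mem_nhds (by simp)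
    filter_upwards [mem_nhdsWithin_of_mem_nhds this, self_mem_nhdsWithin] with x hx hxu h0
    apply hx
    refine ⟨?_, hxu⟩
    rw [mem_rootSet]
    exact ⟨hE, by simpa [aeval_def] using h0⟩
  apply le_antisymm
  · have h1 : ∀ᶠ x in nhdsWithin u (Set.Iio u), φ x ≤ 0 := by
      filter_upwards [mem_nhdsWithin_of_mem_nhds h,
        nhdsWithin_mono u (fun x (hx : x < u) => ne_of_lt hx) hE', self_mem_nhdsWithin]
        with x hx hEx hxu
      have hxu' : x < u := hxu
      have : 0 < E.eval x ^ 2 := by positivity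
      have h2 := nonneg_of_mul_nonneg_left hx this
      by_contra! hc
      nlinarith [mul_pos (sub_pos.2 hxu') hc]
    exact le_of_tendsto (hφ.tendsto.mono_left nhdsWithin_le_nhds) h1
  · have h1 : ∀ᶠ x in nhdsWithin u (Set.Ioi u), 0 ≤ φ x := by
      filter_upwards [mem_nhdsWithin_of_mem_nhds h,
        nhdsWithin_mono u (fun x (hx : u < x) => ne_of_gt hx) hE', self_mem_nhdsWithin]
        with x hx hEx hxu
      have hxu' : u < x := hxu
      have : 0 < E.eval x ^ 2 := by positivity
      have h2 := nonneg_of_mul_nonneg_left hx this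
      exact nonneg_of_mul_nonneg_right h2 (sub_pos.2 hxu')
    exact ge_of_tendsto (hφ.tendsto.mono_left nhdsWithin_le_nhds) h1

/-- The real points of the curve `y² + q(x) = 0`. -/
def realPoints (q : ℝ[X]) : Set (ℝ × ℝ) := {z | z.2 ^ 2 + q.eval z.1 = 0}

lemma exists_bound_of_eval_nonpos {q : ℝ[X]} (hmonic : q.Monic) (hdeg : q.natDegree = 4) :
    ∃ R : ℝ, ∀ x, q.eval x ≤ 0 → |x| ≤ R := by
  have hd : 0 < q.degree := natDegree_pos_iff_degree_pos.1 (by omega)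
  have h1 := q.tendsto_atTop_of_leadingCoeff_nonneg hd (by rw [hmonic.leadingCoeff]; norm_num)
  have hc : (q.comp (-X)).natDegree = 4 := by simp [natDegree_comp, hdeg]
  have hl : (q.comp (-X)).leadingCoeff = 1 := by
    rw [leadingCoeff_comp (by simp), hmonic.leadingCoeff, hdeg]
    simp
    norm_num
  have h2 := (q.comp (-X)).tendsto_atTop_of_leadingCoeff_nonneg
    (natDegree_pos_iff_degree_pos.1 (by omega)) (by rw [hl]; norm_num)
  obtain ⟨R1, hR1⟩ := Filter.eventually_atTop.1 (h1.eventually_gt_atTop 0)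
  obtain ⟨R2, hR2⟩ := Filter.eventually_atTop.1 (h2.eventually_gt_atTop 0)
  refine ⟨max R1 R2, fun x hx => abs_le.2 ⟨?_, ?_⟩⟩
  · by_contra! hc
    have := hR2 (-x) (by linarith [le_max_right R1 R2])
    simp at this
    linarith
  · by_contra! hc
    have := hR1 x (by linarith [le_max_left R1 R2])
    linarith

lemma isCompact_realPoints {q : ℝ[X]} (hmonic : q.Monic) (hdeg : q.natDegree = 4) :
    IsCompact (realPoints q) := by
  obtain ⟨R, hR⟩ := exists_bound_of_eval_nonpos hmonic hdeg
  have hS : IsCompact {x : ℝ | q.eval x ≤ 0} :=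
    (isCompact_Icc (a := -R) (b := R)).of_isClosed_subset
      (isClosed_le q.continuous continuous_const) fun x hx => abs_le.1 (hR x hx)
  have h1 := hS.image (f := fun x => (x, Real.sqrt (-q.eval x))) (by fun_prop)
  have h2 := hS.image (f := fun x => (x, -Real.sqrt (-q.eval x))) (by fun_prop)
  refine (h1.union h2).of_isClosed_subset (isClosed_eq (by fun_prop) (by fun_prop)) ?_
  rintro ⟨u, v⟩ huv
  have huv : v ^ 2 + q.eval u = 0 := huv
  have hq : q.eval u ≤ 0 := by nlinarith [sq_nonneg v]
  have hv : -q.eval u = v ^ 2 := by linarith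
  rcases le_total 0 v with h | h
  · exact Or.inl ⟨u, hq, by simp [hv, Real.sqrt_sq h]⟩
  · exact Or.inr ⟨u, hq, by simp [hv, Real.sqrt_sq_eq_abs, abs_of_nonpos h]⟩

lemma exists_pos_bound {X : Type*} [TopologicalSpace X] {K : Set X} (hK : IsCompact K)
    {φ : X → ℝ} (hφ : Continuous φ) : ∃ c > 0, ∀ z ∈ K, |φ z| ≤ c := by
  obtain ⟨c, hc⟩ := hK.exists_bound_of_continuousOn hφ.continuousOn
  exact ⟨max c 1, by positivity, fun z hz => (hc z hz).trans (le_max_left _ _)⟩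

lemma exists_pos_lower_bound {X : Type*} [TopologicalSpace X] {K : Set X} (hK : IsCompact K)
    {φ : X → ℝ} (hφ : Continuous φ) (hpos : ∀ z ∈ K, 0 < φ z) : ∃ c > 0, ∀ z ∈ K, c ≤ φ z := by
  rcases K.eq_empty_or_nonempty with rfl | hne
  · exact ⟨1, by norm_num, by simp⟩
  · obtain ⟨z, hz, hmin⟩ := hK.exists_isMinOn hne hφ.continuousOn
    exact ⟨φ z, hpos z hz, fun w hw => hmin hw⟩

/-- The value of `a(x) + b(x)·y` at the point `z`. -/
def pairEval (p : ℝ[X] × ℝ[X]) (z : ℝ × ℝ) : ℝ := p.1.eval z.1 + p.2.eval z.1 * z.2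

@[fun_prop]
lemma continuous_pairEval (p : ℝ[X] × ℝ[X]) : Continuous (pairEval p) := by
  unfold pairEval
  fun_prop

/-- Nonnegativity of `a(x) + b(x)·y` on the real points of the curve. -/
def PairPsd (q : ℝ[X]) (p : ℝ[X] × ℝ[X]) : Prop := ∀ z ∈ realPoints q, 0 ≤ pairEval p z

/-- A factorization of `a + b·y` exhibiting half of its real zeros on the curve:
`a + b·y = ∏_e (x - u)² · ∏_f (x - u) · R · (a' + b'·y)` with `a'`, `b'` coprime,
`∏_f (x - u) ∣ q`, and norm `a'² + q b'² = ∏_m (x - u)² · T`, where `R`, `T` have no zeros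
on the projection `{q ≤ 0}` of the real points. -/
structure RealFactorization (q : ℝ[X]) (p : ℝ[X] × ℝ[X]) where
  e : Multiset ℝ
  f : Multiset ℝ
  m : Multiset ℝ
  R : ℝ[X]
  T : ℝ[X]
  a' : ℝ[X]
  b' : ℝ[X]
  he : ∀ x ∈ e, q.eval x ≤ 0
  hf : ∀ x ∈ f, q.eval x = 0
  hm : ∀ x ∈ m, q.eval x ≤ 0
  hR : ∀ x, q.eval x ≤ 0 → R.eval x ≠ 0
  hT : ∀ x, q.eval x ≤ 0 → T.eval x ≠ 0
  dvd : linProd f ∣ q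
  fst_eq : p.1 = linProd e ^ 2 * linProd f * R * a'
  snd_eq : p.2 = linProd e ^ 2 * linProd f * R * b'
  coprime : IsCoprime a' b'
  norm_eq : a' ^ 2 + q * b' ^ 2 = linProd m ^ 2 * T

lemma IsCoprime.not_eval_eq_zero {a b : ℝ[X]} (h : IsCoprime a b) {u : ℝ} (ha : a.eval u = 0)
    (hb : b.eval u = 0) : False := by
  obtain ⟨s, t, hst⟩ := h
  have := congrArg (eval u) hst
  simp [ha, hb] at this

lemma norm_ne_zero_of_isCoprime {q : ℝ[X]} (hmonic : q.Monic) (hdeg : q.natDegree = 4)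
    {a b : ℝ[X]} (h : IsCoprime a b) : a ^ 2 + q * b ^ 2 ≠ 0 := by
  intro h0
  obtain ⟨r, hr⟩ := exists_bound_of_eval_nonpos hmonic hdeg
  have hq : 0 < q.eval (|r| + 1) := by
    by_contra! hc
    have := hr _ hc
    rw [abs_of_pos (by positivity)] at this
    linarith [le_abs_self r]
  have := congrArg (eval (|r| + 1)) h0
  simp only [eval_add, eval_pow, eval_mul, eval_zero] at this
  refine h.not_eval_eq_zero (u := |r| + 1) ?_ ?_
  · have : a.eval (|r| + 1) ^ 2 = 0 := by
      nlinarith [sq_nonneg (a.eval (|r| + 1)), mul_nonneg hq.le (sq_nonneg (b.eval (|r| + 1)))]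
    simpa using this
  · have : q.eval (|r| + 1) * b.eval (|r| + 1) ^ 2 = 0 := by
      nlinarith [sq_nonneg (a.eval (|r| + 1)), mul_nonneg hq.le (sq_nonneg (b.eval (|r| + 1)))]
    simpa [hq.ne'] using this

lemma PairPsd.norm_nonneg {q : ℝ[X]} {p : ℝ[X] × ℝ[X]} (h : PairPsd q p) (x : ℝ) :
    0 ≤ p.1.eval x ^ 2 + q.eval x * p.2.eval x ^ 2 := by
  rcases le_total 0 (q.eval x) with hq | hq
  · positivity
  · have hs : Real.sqrt (-q.eval x) ^ 2 = -q.eval x := Real.sq_sqrt (by linarith)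
    have h1 := h (x, Real.sqrt (-q.eval x)) (by simp [realPoints, hs])
    have h2 := h (x, -Real.sqrt (-q.eval x)) (by simp [realPoints, hs])
    simp only [pairEval] at h1 h2
    have := mul_nonneg h1 h2
    have h3 : q.eval x = -Real.sqrt (-q.eval x) ^ 2 := by linarith
    rw [h3]
    nlinarith

lemma linProd_ne_zero (s : Multiset ℝ) : linProd s ≠ 0 := (linProd_monic s).ne_zero

lemma exists_linProd_eq_mul_of_mem {s : Multiset ℝ} {u : ℝ} (hu : u ∈ s) (hs : s.Nodup) :
    ∃ G : ℝ[X], linProd s = (X - C u) * G ∧ G.eval u ≠ 0 := by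
  classical
  refine ⟨linProd (s.erase u), ?_, fun h => hs.notMem_erase (eval_linProd_eq_zero h)⟩
  rw [← linProd_cons, Multiset.cons_erase hu]

lemma exists_realFactorization {q : ℝ[X]} (hmonic : q.Monic) (hdeg : q.natDegree = 4)
    {p : ℝ[X] × ℝ[X]} (hp0 : p ≠ 0) (hp : PairPsd q p) : Nonempty (RealFactorization q p) := by
  obtain ⟨a, b⟩ := p
  have hg : GCDMonoid.gcd a b ≠ 0 := by
    intro h
    rw [gcd_eq_zero_iff] at h
    exact hp0 (Prod.ext h.1 h.2)
  have hcop := isCoprime_div_gcd_div_gcd_of_gcd_ne_zero hg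
  obtain ⟨D, hD⟩ : ∃ D, D = GCDMonoid.gcd a b := ⟨_, rfl⟩
  obtain ⟨a', ha'⟩ : ∃ a', a' = a / GCDMonoid.gcd a b := ⟨_, rfl⟩
  obtain ⟨b', hb'⟩ : ∃ b', b' = b / GCDMonoid.gcd a b := ⟨_, rfl⟩
  have ha : a = D * a' := by
    rw [ha', hD, EuclideanDomain.mul_div_cancel' hg (gcd_dvd_left a b)]
  have hb : b = D * b' := by
    rw [hb', hD, EuclideanDomain.mul_div_cancel' hg (gcd_dvd_right a b)]
  rw [← ha', ← hb'] at hcop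
  rw [← hD] at hg
  clear hD ha' hb'
  have hN := norm_ne_zero_of_isCoprime hmonic hdeg hcop
  obtain ⟨e, f, R, hfn, he, hf, hR, rfl⟩ := exists_factorization_on {x | q.eval x ≤ 0} hg
  obtain ⟨m, n, T, hnn, hm, hn, hT, hMT⟩ := exists_factorization_on {x | q.eval x ≤ 0} hN
  have hn0 : n = 0 := by
    rw [Multiset.eq_zero_iff_forall_notMem]
    intro u hu
    obtain ⟨G, hG, hGu⟩ := exists_linProd_eq_mul_of_mem hu hnn
    have := eval_eq_zero_of_sign_change (E := linProd e ^ 2 * linProd f * R * linProd m)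
      (mul_ne_zero hg (linProd_ne_zero m)) (φ := fun x => (G * T).eval x) (u := u)
      (by fun_prop) (Filter.Eventually.of_forall fun x => by
        have h1 := hp.norm_nonneg x
        have h2 := congrArg (eval x) hMT
        simp only [ha, hb, hG, eval_add, eval_mul, eval_pow, eval_sub, eval_X, eval_C] at h1 h2 ⊢
        calc _ ≤ _ := h1
          _ = (eval x (linProd e) ^ 2 * eval x (linProd f) * eval x R) ^ 2 *
              (eval x a' ^ 2 + eval x q * eval x b' ^ 2) := by ring
          _ = _ := by rw [h2]; ring)
    simp only [eval_mul, mul_eq_zero] at this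
    exact this.elim hGu (hT u (hn u hu))
  have hf0 : ∀ u ∈ f, q.eval u = 0 := by
    intro u hu
    by_contra hq0
    have hq : q.eval u < 0 := lt_of_le_of_ne (hf u hu) hq0
    obtain ⟨G, hG, hGu⟩ := exists_linProd_eq_mul_of_mem hu hfn
    have hnear : ∀ᶠ x in nhds u, q.eval x < 0 :=
      q.continuous.continuousAt.eventually (gt_mem_nhds hq)
    have key : ∀ σ : ℝ, σ ^ 2 = 1 → a'.eval u + b'.eval u * (σ * Real.sqrt (-q.eval u)) = 0 := by
      intro σ hσ
      have := eval_eq_zero_of_sign_change (E := linProd e) (linProd_ne_zero e)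
        (φ := fun x => G.eval x * R.eval x *
          (a'.eval x + b'.eval x * (σ * Real.sqrt (-q.eval x)))) (u := u)
        (by fun_prop) (by
          filter_upwards [hnear] with x hx
          have hs : Real.sqrt (-q.eval x) ^ 2 = -q.eval x := Real.sq_sqrt (by linarith)
          have h1 := hp (x, σ * Real.sqrt (-q.eval x)) (by simp [realPoints, mul_pow, hs, hσ])
          simp only [pairEval, ha, hb, hG, eval_mul, eval_pow, eval_sub, eval_X, eval_C] at h1
          linarith)
      simp only [mul_eq_zero] at this
      rcases this with (h | h) | h
      · exact absurd h hGu
      · exact absurd h (hR u hq.le)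
      · exact h
    have h1 := key 1 (by norm_num)
    have h2 := key (-1) (by norm_num)
    have hs : Real.sqrt (-q.eval u) ≠ 0 := (Real.sqrt_pos.2 (by linarith)).ne'
    refine hcop.not_eval_eq_zero (u := u) (by linarith) ?_
    have : b'.eval u * Real.sqrt (-q.eval u) = 0 := by linarith
    simpa [hs] using this
  refine ⟨⟨e, f, m, R, T, a', b', he, hf0, hm, hR, hT, ?_, ha, hb, hcop, ?_⟩⟩
  · refine (Multiset.prod_X_sub_C_dvd_iff_le_roots hmonic.ne_zero f).2 ?_
    rw [Multiset.le_iff_subset hfn]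
    exact fun u hu => (mem_roots hmonic.ne_zero).2 (hf0 u hu)
  · rw [hMT, hn0]
    simp [linProd]

namespace RealFactorization

variable {q : ℝ[X]} {p : ℝ[X] × ℝ[X]}

/-- The element `E·(F·A + B·y)` with `E = ∏_e (x - u)`, `F = ∏_f (x - u)`. -/
def toPair (W : RealFactorization q p) (A B : ℝ[X]) : ℝ[X] × ℝ[X] :=
  (linProd W.e * linProd W.f * A, linProd W.e * B)

lemma eval_nonpos_of_mem {z : ℝ × ℝ} (hz : z ∈ realPoints q) : q.eval z.1 ≤ 0 := by
  have hz : z.2 ^ 2 + q.eval z.1 = 0 := hz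
  nlinarith [sq_nonneg z.2]

/-- The cofactor `a' + b'·y` has no common real zero on the curve with `b'² ∏_f (x - u)`. -/
lemma cofactor_ne_zero (W : RealFactorization q p)
    (hreg : ∀ u, q.eval u = 0 → q.derivative.eval u ≠ 0) {z : ℝ × ℝ} (hz : z ∈ realPoints q)
    (h : W.a'.eval z.1 + W.b'.eval z.1 * z.2 = 0) :
    W.b'.eval z.1 ^ 2 * (linProd W.f).eval z.1 ≠ 0 := by
  obtain ⟨u, v⟩ := z
  have hz' : v ^ 2 + q.eval u = 0 := hz
  have hqu := eval_nonpos_of_mem hz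
  simp only at h hqu ⊢
  have hb : W.b'.eval u ≠ 0 := by
    intro hb
    rw [hb, zero_mul, add_zero] at h
    exact W.coprime.not_eval_eq_zero h hb
  refine mul_ne_zero (pow_ne_zero _ hb) fun hF => ?_
  have hq0 := W.hf u (eval_linProd_eq_zero hF)
  have hv : v = 0 := by simpa [hq0] using hz'
  have ha : W.a'.eval u = 0 := by simpa [hv] using h
  have hN := congrArg (eval u) W.norm_eq
  have hN' := congrArg (eval u) (congrArg derivative W.norm_eq)
  simp only [eval_add, eval_pow, eval_mul, ha, hq0] at hN
  have hM : (linProd W.m).eval u = 0 := by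
    have : (linProd W.m).eval u ^ 2 * W.T.eval u = 0 := by rw [← hN]; ring
    simpa [W.hT u hqu] using this
  simp only [derivative_add, derivative_mul, derivative_pow, eval_add, eval_pow, eval_mul, ha, hq0,
    hM] at hN'
  have : q.derivative.eval u * W.b'.eval u ^ 2 = 0 := by
    simpa using hN'
  simp [hb, hreg u hq0] at this

lemma exists_dominated (W : RealFactorization q p) (hmonic : q.Monic) (hdeg : q.natDegree = 4)
    (hreg : ∀ u, q.eval u = 0 → q.derivative.eval u ≠ 0) (hp : PairPsd q p) {A B L : ℝ[X]}
    (hL : linProd W.f * A * W.b' - W.a' * B = linProd W.m * L) :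
    ∃ c : ℝ, ∀ z ∈ realPoints q, pairEval (W.toPair A B) z ^ 2 ≤ c * pairEval p z := by
  have hK := isCompact_realPoints hmonic hdeg
  obtain ⟨G, hG⟩ := W.dvd
  obtain ⟨cR, hcR, hRbd⟩ := exists_pos_lower_bound hK (φ := fun z => |W.R.eval z.1|)
    (by fun_prop) fun z hz => abs_pos.2 (W.hR _ (eval_nonpos_of_mem hz))
  let h' : ℝ × ℝ → ℝ := fun z => W.a'.eval z.1 + W.b'.eval z.1 * z.2
  let ψ : ℝ × ℝ → ℝ := fun z => (linProd W.f).eval z.1 * A.eval z.1 ^ 2 +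
    2 * A.eval z.1 * B.eval z.1 * z.2 - B.eval z.1 ^ 2 * G.eval z.1
  let κ : ℝ × ℝ → ℝ := fun z => W.b'.eval z.1 ^ 2 * (linProd W.f).eval z.1
  let χ : ℝ × ℝ → ℝ := fun z => (W.a'.eval z.1 - W.b'.eval z.1 * z.2) * L.eval z.1 ^ 2 +
    W.T.eval z.1 * (2 * (linProd W.m).eval z.1 * L.eval z.1 * B.eval z.1 + B.eval z.1 ^ 2 * h' z)
  obtain ⟨c, hc, hlow⟩ := exists_pos_lower_bound hK
    (φ := fun z => |W.T.eval z.1| * (|h' z| + |κ z|)) (by fun_prop) fun z hz => by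
      refine mul_pos (abs_pos.2 (W.hT _ (eval_nonpos_of_mem hz))) ?_
      by_cases h0 : h' z = 0
      · have := abs_pos.2 (W.cofactor_ne_zero hreg hz h0)
        positivity
      · have := abs_pos.2 h0
        positivity
  obtain ⟨c1, hc1, hbd1⟩ := exists_pos_bound hK (φ := χ) (by fun_prop)
  obtain ⟨c2, hc2, hbd2⟩ := exists_pos_bound hK (φ := fun z => W.T.eval z.1 * ψ z) (by fun_prop)
  refine ⟨(c1 + c2) / (c * cR), fun z hz => ?_⟩
  have hqz := congrArg (eval z.1) hG
  rw [eval_mul] at hqz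
  have hcurve : z.2 ^ 2 = -((linProd W.f).eval z.1 * G.eval z.1) := by
    have h1 : z.2 ^ 2 + q.eval z.1 = 0 := hz
    linarith
  have eN := congrArg (eval z.1) W.norm_eq
  have eL := congrArg (eval z.1) hL
  simp only [eval_add, eval_sub, eval_mul, eval_pow] at eN eL
  rw [hqz] at eN
  have hFψ : (linProd W.f).eval z.1 * ψ z =
      ((linProd W.f).eval z.1 * A.eval z.1 + B.eval z.1 * z.2) ^ 2 := by
    simp only [ψ]
    linear_combination (-B.eval z.1 ^ 2) * hcurve
  have hκψ : W.T.eval z.1 * (κ z * ψ z) = h' z * χ z := by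
    have h1 : κ z * ψ z = ((linProd W.m).eval z.1 * L.eval z.1 + B.eval z.1 * h' z) ^ 2 := by
      calc κ z * ψ z = W.b'.eval z.1 ^ 2 * ((linProd W.f).eval z.1 * ψ z) := by simp only [κ]; ring
        _ = _ := by rw [hFψ, ← eL]; simp only [h']; ring
    have h2 : (linProd W.m).eval z.1 ^ 2 * W.T.eval z.1 =
        h' z * (W.a'.eval z.1 - W.b'.eval z.1 * z.2) := by
      rw [← eN]
      simp only [h']
      linear_combination (W.b'.eval z.1 ^ 2) * hcurve
    rw [h1]
    simp only [χ]
    linear_combination (L.eval z.1 ^ 2) * h2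
  have hψ : |ψ z| * c ≤ (c1 + c2) * |h' z| := by
    calc |ψ z| * c ≤ |ψ z| * (|W.T.eval z.1| * (|h' z| + |κ z|)) := by
          gcongr
          exact hlow z hz
      _ = |W.T.eval z.1 * (κ z * ψ z)| + |h' z| * |W.T.eval z.1 * ψ z| := by
          simp only [abs_mul]; ring
      _ = |h' z| * |χ z| + |h' z| * |W.T.eval z.1 * ψ z| := by rw [hκψ, abs_mul]
      _ ≤ |h' z| * c1 + |h' z| * c2 := by
          gcongr
          exacts [hbd1 z hz, hbd2 z hz]
      _ = _ := by ring
  have hh : pairEval p z = (linProd W.e).eval z.1 ^ 2 * |(linProd W.f).eval z.1| *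
      |W.R.eval z.1| * |h' z| := by
    rw [← abs_of_nonneg (hp z hz)]
    have : pairEval p z = (linProd W.e).eval z.1 ^ 2 * (linProd W.f).eval z.1 *
        W.R.eval z.1 * h' z := by
      simp only [pairEval, W.fst_eq, W.snd_eq, eval_mul, eval_pow, h']
      ring
    rw [this]
    simp only [abs_mul, abs_pow, sq_abs]
  have hg : pairEval (W.toPair A B) z ^ 2 =
      (linProd W.e).eval z.1 ^ 2 * |(linProd W.f).eval z.1| * |ψ z| := by
    rw [mul_assoc, ← abs_mul, hFψ, abs_sq]
    simp only [pairEval, toPair, eval_mul]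
    ring
  rw [hg, hh, div_mul_eq_mul_div, le_div_iff₀ (by positivity)]
  calc _ = (linProd W.e).eval z.1 ^ 2 * |(linProd W.f).eval z.1| * (|ψ z| * c) * cR := by ring
    _ ≤ (linProd W.e).eval z.1 ^ 2 * |(linProd W.f).eval z.1| * ((c1 + c2) * |h' z|) *
        |W.R.eval z.1| := by
      gcongr
      exact hRbd z hz
    _ = _ := by ring

end RealFactorization

/-- All complex zeros of `a(x) + b(x)·y` on the curve are real. -/
def PairZerosReal (q : ℝ[X]) (p : ℝ[X] × ℝ[X]) : Prop :=
  ∀ u v : ℂ, v ^ 2 + (q.map (algebraMap ℝ ℂ)).eval u = 0 →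
    (p.1.map (algebraMap ℝ ℂ)).eval u + (p.2.map (algebraMap ℝ ℂ)).eval u * v = 0 →
    u.im = 0 ∧ v.im = 0

/-- The pairs `(a, b)` with `deg a ≤ d` and `2 + deg b ≤ d`. -/
def pairLE (d : ℕ) : Submodule ℝ (ℝ[X] × ℝ[X]) := (degreeLT ℝ (d + 1)).prod (degreeLT ℝ (d - 1))

lemma mem_degreeLT_iff {p : ℝ[X]} {n : ℕ} : p ∈ degreeLT ℝ n ↔ p = 0 ∨ p.natDegree < n := by
  rw [mem_degreeLT]
  by_cases hp : p = 0
  · simp [hp]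
  · simp [hp, natDegree_lt_iff_degree_lt hp]

lemma mem_pairLE {p : ℝ[X] × ℝ[X]} {d : ℕ} :
    p ∈ pairLE d ↔ p.1.natDegree ≤ d ∧ (p.2 = 0 ∨ 2 + p.2.natDegree ≤ d) := by
  rw [pairLE, Submodule.mem_prod, mem_degreeLT_iff, mem_degreeLT_iff]
  refine and_congr ⟨?_, fun h => Or.inr (by omega)⟩ (or_congr_right (by omega))
  rintro (h | h)
  · simp [h]
  · omega

lemma im_eq_zero_of_sq_eq_ofReal_nonneg {v : ℂ} {r : ℝ} (hr : 0 ≤ r) (h : v ^ 2 = (r : ℂ)) :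
    v.im = 0 := by
  have hre := congrArg Complex.re h
  have him := congrArg Complex.im h
  simp only [pow_two, Complex.mul_re, Complex.mul_im, Complex.ofReal_re, Complex.ofReal_im]
    at hre him
  by_contra hv
  have h0 : v.re = 0 := by
    have : v.re * v.im = 0 := by linarith
    simpa [hv] using this
  rw [h0] at hre
  have : 0 < v.im * v.im := mul_self_pos.2 hv
  linarith

lemma natDegree_norm_le {q : ℝ[X]} (hdeg : q.natDegree = 4) {p : ℝ[X] × ℝ[X]} {d : ℕ}
    (hp : p ∈ pairLE d) : (p.1 ^ 2 + q * p.2 ^ 2).natDegree ≤ 2 * d := by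
  obtain ⟨h1, h2⟩ := mem_pairLE.1 hp
  refine natDegree_add_le_of_degree_le ?_ ?_
  · exact natDegree_pow_le.trans (by omega)
  · rcases h2 with h2 | h2
    · simp [h2]
    · refine natDegree_mul_le.trans ?_
      have := natDegree_pow_le (p := p.2) (n := 2)
      omega

namespace RealFactorization

variable {q : ℝ[X]} {p : ℝ[X] × ℝ[X]}

lemma norm_eq_prod (W : RealFactorization q p) : p.1 ^ 2 + q * p.2 ^ 2 =
    (linProd W.e ^ 2 * linProd W.f * W.R) ^ 2 * (linProd W.m ^ 2 * W.T) := by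
  rw [W.fst_eq, W.snd_eq, ← W.norm_eq]
  ring

lemma zerosReal_of_natDegree_eq_zero (W : RealFactorization q p)
    (hindef : ∃ x : ℝ, q.eval x < 0) (hR : W.R.natDegree = 0) (hT : W.T.natDegree = 0) :
    PairZerosReal q p := by
  obtain ⟨x₀, hx₀⟩ := hindef
  intro u v hv h0
  obtain ⟨r, hr⟩ := natDegree_eq_zero.1 hR
  obtain ⟨t, ht⟩ := natDegree_eq_zero.1 hT
  have hr0 : r ≠ 0 := by simpa [← hr] using W.hR x₀ hx₀.le
  have ht0 : t ≠ 0 := by simpa [← ht] using W.hT x₀ hx₀.le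
  have hN := congrArg (fun g => (g.map (algebraMap ℝ ℂ)).eval u) W.norm_eq_prod
  simp only [← hr, ← ht, Polynomial.map_add, Polynomial.map_mul, Polynomial.map_pow, eval_add,
    eval_mul, eval_pow, map_C, eval_C] at hN
  have hL : ((p.1.map (algebraMap ℝ ℂ)).eval u) ^ 2 + (q.map (algebraMap ℝ ℂ)).eval u *
      ((p.2.map (algebraMap ℝ ℂ)).eval u) ^ 2 = 0 := by
    linear_combination ((p.2.map (algebraMap ℝ ℂ)).eval u) ^ 2 * hv +
      ((p.1.map (algebraMap ℝ ℂ)).eval u - (p.2.map (algebraMap ℝ ℂ)).eval u * v) * h0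
  rw [hL] at hN
  have hS : ∃ a : ℝ, q.eval a ≤ 0 ∧ u = (a : ℂ) := by
    have := hN.symm
    simp only [mul_eq_zero, pow_eq_zero_iff, ne_eq, OfNat.ofNat_ne_zero, not_false_eq_true,
      Complex.coe_algebraMap, Complex.ofReal_eq_zero, hr0, ht0, or_false] at this
    rcases this with (h | h) | h
    · obtain ⟨a, ha, rfl⟩ := aeval_linProd_eq_zero h
      exact ⟨a, W.he a ha, rfl⟩
    · obtain ⟨a, ha, rfl⟩ := aeval_linProd_eq_zero h
      exact ⟨a, (W.hf a ha).le, rfl⟩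
    · obtain ⟨a, ha, rfl⟩ := aeval_linProd_eq_zero h
      exact ⟨a, W.hm a ha, rfl⟩
  obtain ⟨a, ha, rfl⟩ := hS
  refine ⟨by simp, im_eq_zero_of_sq_eq_ofReal_nonneg (r := -q.eval a) (by linarith) ?_⟩
  have : (q.map (algebraMap ℝ ℂ)).eval (a : ℂ) = ((q.eval a : ℝ) : ℂ) := by
    rw [eval_map]
    exact eval₂_at_apply (algebraMap ℝ ℂ) a
  rw [this] at hv
  push_cast
  linear_combination hv

lemma card_lt (W : RealFactorization q p) (hdeg : q.natDegree = 4)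
    (hindef : ∃ x : ℝ, q.eval x < 0) {d : ℕ} (hp : p ∈ pairLE d) (hz : ¬ PairZerosReal q p) :
    2 * Multiset.card W.e + Multiset.card W.f + Multiset.card W.m < d := by
  have hnd := natDegree_norm_le hdeg hp
  have hne : W.R.natDegree ≠ 0 ∨ W.T.natDegree ≠ 0 := by
    by_contra! h
    exact hz (W.zerosReal_of_natDegree_eq_zero hindef h.1 h.2)
  obtain ⟨x₀, hx₀⟩ := hindef
  have hR : W.R ≠ 0 := fun h => W.hR x₀ hx₀.le (by simp [h])
  have hT : W.T ≠ 0 := fun h => W.hT x₀ hx₀.le (by simp [h])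
  have he := linProd_ne_zero W.e
  have hf := linProd_ne_zero W.f
  have hm := linProd_ne_zero W.m
  rw [W.norm_eq_prod, natDegree_mul (by positivity) (by positivity), natDegree_pow,
    natDegree_mul (by positivity) hR, natDegree_mul (by positivity) hf, natDegree_pow,
    natDegree_mul (by positivity) hT, natDegree_pow] at hnd
  simp only [linProd_natDegree] at hnd
  omega

end RealFactorization

/-- The square of `a + b·y` modulo `y² + q`. -/
def pairSq (q : ℝ[X]) (p : ℝ[X] × ℝ[X]) : ℝ[X] × ℝ[X] :=
  (p.1 ^ 2 - q * p.2 ^ 2, 2 * p.1 * p.2)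

lemma pairSq_mem {q : ℝ[X]} (hdeg : q.natDegree = 4) {g : ℝ[X] × ℝ[X]} {k : ℕ}
    (hg : g ∈ pairLE k) : pairSq q g ∈ pairLE (2 * k) := by
  obtain ⟨h1, h2⟩ := mem_pairLE.1 hg
  refine mem_pairLE.2 ⟨(natDegree_sub_le _ _).trans (max_le ?_ ?_), ?_⟩
  · exact natDegree_pow_le.trans (by omega)
  · rcases h2 with h2 | h2
    · simp [h2]
    · refine natDegree_mul_le.trans ?_
      have := natDegree_pow_le (p := g.2) (n := 2)
      omega
  · rcases h2 with h2 | h2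
    · exact Or.inl (by simp [pairSq, h2])
    · refine Or.inr ?_
      have h3 : (2 * g.1 * g.2).natDegree ≤ (2 * g.1).natDegree + g.2.natDegree := natDegree_mul_le
      have h4 : (2 * g.1).natDegree ≤ (2 : ℝ[X]).natDegree + g.1.natDegree := natDegree_mul_le
      have h5 : (2 : ℝ[X]).natDegree = 0 := natDegree_ofNat 2
      simp only [pairSq]
      omega

lemma degreeLT_of_coeff_eq_zero {p : ℝ[X]} {n : ℕ} (hp : p ∈ degreeLT ℝ (n + 1))
    (h : p.coeff n = 0) : p ∈ degreeLT ℝ n := by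
  rw [mem_degreeLT, degree_lt_iff_coeff_zero] at hp ⊢
  intro m hm
  rcases hm.eq_or_lt with rfl | hm
  · exact h
  · exact hp m hm

lemma mem_pairLE_pred {g : ℝ[X] × ℝ[X]} {k : ℕ} (hg : g ∈ pairLE k) (hk : 1 ≤ k)
    (h1 : g.1.coeff k = 0) (h2 : (X ^ 2 * g.2).coeff k = 0) : g ∈ pairLE (k - 1) := by
  obtain ⟨hg1, hg2⟩ := Submodule.mem_prod.1 hg
  rcases k with _ | _ | j
  · omega
  · exact Submodule.mem_prod.2 ⟨degreeLT_of_coeff_eq_zero hg1 h1, hg2⟩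
  · exact Submodule.mem_prod.2 ⟨degreeLT_of_coeff_eq_zero hg1 h1,
      degreeLT_of_coeff_eq_zero hg2 (by rwa [coeff_X_pow_mul] at h2)⟩

lemma pairSq_add_pairSq_mem {q : ℝ[X]} (hmonic : q.Monic) (hdeg : q.natDegree = 4)
    {g₁ g₂ : ℝ[X] × ℝ[X]} {k : ℕ} (hg₁ : g₁ ∈ pairLE k) (hg₂ : g₂ ∈ pairLE k)
    (h₁ : g₁.1.coeff k = 1) (h₁' : (X ^ 2 * g₁.2).coeff k = 0)
    (h₂ : g₂.1.coeff k = 0) (h₂' : (X ^ 2 * g₂.2).coeff k = 1) :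
    pairSq q g₁ + pairSq q g₂ ∈ pairLE (2 * k - 1) := by
  obtain ⟨hd₁, he₁⟩ := mem_pairLE.1 hg₁
  obtain ⟨hd₂, he₂⟩ := mem_pairLE.1 hg₂
  have hk : 2 ≤ k := by
    rcases he₂ with h | h
    · simp [h] at h₂'
    · omega
  obtain ⟨j, rfl⟩ := Nat.exists_eq_add_of_le' hk
  have hn₁ : g₁.2.natDegree ≤ j := by
    rcases he₁ with h | h
    · simp [h]
    · omega
  have hn₂ : g₂.2.natDegree ≤ j := by
    rcases he₂ with h | h
    · simp [h]
    · omega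
  rw [coeff_X_pow_mul] at h₁' h₂'
  have hmem := (pairLE (2 * (j + 2))).add_mem (pairSq_mem hdeg hg₁) (pairSq_mem hdeg hg₂)
  refine mem_pairLE_pred hmem (by omega) ?_ ?_
  · have hq : q.coeff 4 = 1 := by rw [← hdeg]; exact hmonic.coeff_natDegree
    have ha : ∀ a : ℝ[X], a.natDegree ≤ j + 2 → (a ^ 2).coeff (2 * (j + 2)) =
        a.coeff (j + 2) ^ 2 := fun a h => by
      rw [two_mul, pow_two, pow_two, coeff_mul_add_eq_of_natDegree_le h h]
    have hb : ∀ b : ℝ[X], b.natDegree ≤ j → (q * b ^ 2).coeff (2 * (j + 2)) =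
        b.coeff j ^ 2 := fun b h => by
      rw [show 2 * (j + 2) = 4 + (j + j) by ring, coeff_mul_add_eq_of_natDegree_le hdeg.le
        (natDegree_pow_le.trans (by omega)), pow_two, coeff_mul_add_eq_of_natDegree_le h h, hq,
        one_mul, pow_two]
    simp only [pairSq, Prod.fst_add, coeff_add, coeff_sub]
    rw [ha _ hd₁, ha _ hd₂, hb _ hn₁, hb _ hn₂, h₁, h₁', h₂, h₂']
    norm_num
  · have hab : ∀ a b : ℝ[X], a.natDegree ≤ j + 2 → b.natDegree ≤ j →
        (2 * a * b).coeff (j + 2 + j) = 2 * (a.coeff (j + 2) * b.coeff j) := fun a b ha hb => by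
      rw [mul_assoc, ← coeff_mul_add_eq_of_natDegree_le ha hb, coeff_ofNat_mul]
    rw [show 2 * (j + 2) = (j + 2 + j) + 2 by ring, coeff_X_pow_mul]
    simp only [pairSq, Prod.snd_add, coeff_add]
    rw [hab _ _ hd₁ hn₁, hab _ _ hd₂ hn₂, h₁, h₁', h₂, h₂']
    norm_num

lemma exists_ker_or_exists_pair {V W : Type*} [AddCommGroup V] [Module ℝ V]
    [AddCommGroup W] [Module ℝ W] [FiniteDimensional ℝ V] [FiniteDimensional ℝ W]
    (φ : V →ₗ[ℝ] W) (lead : V →ₗ[ℝ] ℝ × ℝ)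
    (h : Module.finrank ℝ W + 2 ≤ Module.finrank ℝ V) :
    (∃ v ≠ 0, φ v = 0 ∧ lead v = 0) ∨
      ∃ v₁ v₂, φ v₁ = 0 ∧ φ v₂ = 0 ∧ lead v₁ = (1, 0) ∧ lead v₂ = (0, 1) := by
  by_cases hker : LinearMap.ker (φ.prod lead) = ⊥
  · right
    have hinj := LinearMap.ker_eq_bot.1 hker
    have hfin : Module.finrank ℝ (W × ℝ × ℝ) = Module.finrank ℝ W + 2 := by
      simp [Module.finrank_prod]
    have hle := LinearMap.finrank_le_finrank_of_injective hinj
    have hsurj := (LinearMap.injective_iff_surjective_of_finrank_eq_finrank (by omega)).1 hinj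
    obtain ⟨v₁, h₁⟩ := hsurj (0, (1, 0))
    obtain ⟨v₂, h₂⟩ := hsurj (0, (0, 1))
    exact ⟨v₁, v₂, congrArg Prod.fst h₁, congrArg Prod.fst h₂, congrArg Prod.snd h₁,
      congrArg Prod.snd h₂⟩
  · left
    obtain ⟨v, hv, hv0⟩ := (Submodule.ne_bot_iff _).1 hker
    have hv : φ.prod lead v = 0 := hv
    exact ⟨v, hv0, congrArg Prod.fst hv, congrArg Prod.snd hv⟩

lemma finrank_degreeLT (n : ℕ) : Module.finrank ℝ (degreeLT ℝ n) = n := by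
  rw [(degreeLTEquiv ℝ n).finrank_eq]
  simp

instance finiteDimensional_degreeLT (n : ℕ) : FiniteDimensional ℝ (degreeLT ℝ n) :=
  (degreeLTEquiv ℝ n).symm.finiteDimensional

namespace RealFactorization

variable {q : ℝ[X]} {p : ℝ[X] × ℝ[X]}

/-- The space of coefficient pairs `(A, B)` for which `W.toPair A B` lies in `pairLE k`. -/
abbrev CoeffSpace (W : RealFactorization q p) (k : ℕ) : Type :=
  degreeLT ℝ (k + 1 - (Multiset.card W.e + Multiset.card W.f)) ×
    degreeLT ℝ (k - 1 - Multiset.card W.e)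

/-- The conditions for `W.toPair A B` to be dominated by `p`. -/
def conditions (W : RealFactorization q p) (k : ℕ) :
    W.CoeffSpace k →ₗ[ℝ] (Fin (Multiset.card W.m) → ℝ) :=
  LinearMap.pi fun i => lcoeff ℝ i ∘ₗ modByMonicHom (linProd W.m) ∘ₗ
    (LinearMap.mulLeft ℝ (linProd W.f * W.b') ∘ₗ Submodule.subtype _ ∘ₗ LinearMap.fst ℝ _ _ -
      LinearMap.mulLeft ℝ W.a' ∘ₗ Submodule.subtype _ ∘ₗ LinearMap.snd ℝ _ _)

/-- The coefficients of `W.toPair A B` of weight `k`. -/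
def leading (W : RealFactorization q p) (k : ℕ) : W.CoeffSpace k →ₗ[ℝ] ℝ × ℝ :=
  (lcoeff ℝ k ∘ₗ LinearMap.mulLeft ℝ (linProd W.e * linProd W.f) ∘ₗ Submodule.subtype _ ∘ₗ
      LinearMap.fst ℝ _ _).prod
    (lcoeff ℝ k ∘ₗ LinearMap.mulLeft ℝ (X ^ 2 * linProd W.e) ∘ₗ Submodule.subtype _ ∘ₗ
      LinearMap.snd ℝ _ _)

lemma exists_of_conditions_eq_zero (W : RealFactorization q p) {k : ℕ} {v : W.CoeffSpace k}
    (h : W.conditions k v = 0) :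
    ∃ L : ℝ[X], linProd W.f * (v.1 : ℝ[X]) * W.b' - W.a' * v.2 = linProd W.m * L := by
  rw [← dvd_def, ← modByMonic_eq_zero_iff_dvd (linProd_monic _)]
  ext i
  rw [coeff_zero]
  by_cases hi : i < Multiset.card W.m
  · have := congrFun h ⟨i, hi⟩
    simp only [conditions, LinearMap.pi_apply, LinearMap.comp_apply, LinearMap.sub_apply,
      LinearMap.mulLeft_apply, LinearMap.fst_apply, LinearMap.snd_apply, Submodule.subtype_apply,
      lcoeff_apply, Pi.zero_apply] at this
    rw [mul_right_comm]
    exact this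
  · refine coeff_eq_zero_of_degree_lt ((degree_modByMonic_lt _ (linProd_monic _)).trans_le ?_)
    rw [degree_eq_natDegree (linProd_ne_zero _), linProd_natDegree]
    exact_mod_cast not_lt.1 hi

lemma toPair_mem (W : RealFactorization q p) {k : ℕ} (v : W.CoeffSpace k) :
    W.toPair v.1 v.2 ∈ pairLE k := by
  have h1 := mem_degreeLT_iff.1 v.1.2
  have h2 := mem_degreeLT_iff.1 v.2.2
  refine mem_pairLE.2 ⟨?_, ?_⟩
  · rcases h1 with h1 | h1
    · simp [toPair, h1]
    · refine natDegree_mul_le.trans ?_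
      have := natDegree_mul_le (p := linProd W.e) (q := linProd W.f)
      simp only [linProd_natDegree] at this
      omega
  · rcases h2 with h2 | h2
    · simp [toPair, h2]
    · right
      have := natDegree_mul_le (p := linProd W.e) (q := (v.2 : ℝ[X]))
      rw [linProd_natDegree] at this
      simp only [toPair]
      omega

lemma toPair_ne_zero (W : RealFactorization q p) {k : ℕ} {v : W.CoeffSpace k} (hv : v ≠ 0) :
    W.toPair v.1 v.2 ≠ 0 := by
  intro h
  apply hv
  simp only [toPair, Prod.mk_eq_zero, mul_eq_zero, linProd_ne_zero, false_or,
    ZeroMemClass.coe_eq_zero] at h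
  exact Prod.ext h.1 h.2

lemma finrank_coeffSpace (W : RealFactorization q p) (k : ℕ) :
    Module.finrank ℝ (W.CoeffSpace k) =
      (k + 1 - (Multiset.card W.e + Multiset.card W.f)) + (k - 1 - Multiset.card W.e) := by
  rw [Module.finrank_prod, finrank_degreeLT, finrank_degreeLT]

lemma leading_fst (W : RealFactorization q p) {k : ℕ} (v : W.CoeffSpace k) :
    (W.leading k v).1 = (W.toPair v.1 v.2).1.coeff k := rfl

lemma leading_snd (W : RealFactorization q p) {k : ℕ} (v : W.CoeffSpace k) :
    (W.leading k v).2 = (X ^ 2 * (W.toPair v.1 v.2).2).coeff k := by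
  simp only [toPair, ← mul_assoc]
  rfl

end RealFactorization

/-- `g²` is bounded by a multiple of `p` on the real points. -/
def SqDominated (q : ℝ[X]) (p g : ℝ[X] × ℝ[X]) : Prop :=
  ∃ c : ℝ, ∀ z ∈ realPoints q, pairEval g z ^ 2 ≤ c * pairEval p z

lemma exists_sqDominated {q : ℝ[X]} (hmonic : q.Monic) (hdeg : q.natDegree = 4)
    (hreg : ∀ u, q.eval u = 0 → q.derivative.eval u ≠ 0) (hindef : ∃ x : ℝ, q.eval x < 0)
    {p : ℝ[X] × ℝ[X]} {d : ℕ} (hp0 : p ≠ 0) (hp : PairPsd q p) (hpd : p ∈ pairLE d)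
    (hz : ¬ PairZerosReal q p) :
    ∃ g₁ ∈ pairLE ((d + 1) / 2), ∃ g₂ ∈ pairLE ((d + 1) / 2), g₁ ≠ 0 ∧
      SqDominated q p g₁ ∧ SqDominated q p g₂ ∧ pairSq q g₁ + pairSq q g₂ ∈ pairLE d := by
  obtain ⟨W⟩ := exists_realFactorization hmonic hdeg hp0 hp
  have hcard := W.card_lt hdeg hindef hpd hz
  have hdom : ∀ (k : ℕ) (v : W.CoeffSpace k), W.conditions k v = 0 →
      SqDominated q p (W.toPair v.1 v.2) := fun k v hv => by
    obtain ⟨L, hL⟩ := W.exists_of_conditions_eq_zero hv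
    exact W.exists_dominated hmonic hdeg hreg hp hL
  have hzero : SqDominated q p 0 := ⟨0, by simp [pairEval]⟩
  have hsq0 : pairSq q 0 = 0 := by simp [pairSq]
  rcases Nat.even_or_odd' d with ⟨k, rfl | rfl⟩
  · have hk : (2 * k + 1) / 2 = k := by omega
    rw [hk]
    have hfin := W.finrank_coeffSpace k
    obtain ⟨v, hv, hv0⟩ := (Submodule.ne_bot_iff _).1
      ((W.conditions k).ker_ne_bot_of_finrank_lt (by
        rw [hfin, Module.finrank_fin_fun]
        omega))
    refine ⟨_, W.toPair_mem v, 0, zero_mem _, W.toPair_ne_zero hv0, hdom k v hv, hzero, ?_⟩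
    rw [hsq0, add_zero]
    exact pairSq_mem hdeg (W.toPair_mem v)
  · have hk : (2 * k + 1 + 1) / 2 = k + 1 := by omega
    rw [hk]
    have hfin := W.finrank_coeffSpace (k + 1)
    rcases exists_ker_or_exists_pair (W.conditions (k + 1)) (W.leading (k + 1)) (by
        rw [hfin, Module.finrank_fin_fun]
        omega) with ⟨v, hv0, hv, hl⟩ | ⟨v₁, v₂, hv₁, hv₂, hl₁, hl₂⟩
    · refine ⟨_, W.toPair_mem v, 0, zero_mem _, W.toPair_ne_zero hv0, hdom _ v hv, hzero, ?_⟩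
      have := mem_pairLE_pred (W.toPair_mem v) (by omega)
        (by rw [← W.leading_fst, hl]; rfl) (by rw [← W.leading_snd, hl]; rfl)
      obtain ⟨h1, h2⟩ := mem_pairLE.1 (pairSq_mem hdeg this)
      rw [hsq0, add_zero]
      exact mem_pairLE.2 ⟨by omega, h2.imp_right (by omega)⟩
    · refine ⟨_, W.toPair_mem v₁, _, W.toPair_mem v₂, W.toPair_ne_zero ?_, hdom _ v₁ hv₁,
        hdom _ v₂ hv₂, ?_⟩
      · rintro rfl
        simpa using congrArg Prod.fst hl₁
      · have hd : 2 * k + 1 = 2 * (k + 1) - 1 := by omega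
        rw [hd]
        exact pairSq_add_pairSq_mem hmonic hdeg (W.toPair_mem v₁) (W.toPair_mem v₂)
          (by rw [← W.leading_fst, hl₁]) (by rw [← W.leading_snd, hl₁])
          (by rw [← W.leading_fst, hl₂]) (by rw [← W.leading_snd, hl₂])

lemma pairEval_add (p g : ℝ[X] × ℝ[X]) (z : ℝ × ℝ) :
    pairEval (p + g) z = pairEval p z + pairEval g z := by
  simp only [pairEval, Prod.fst_add, Prod.snd_add, eval_add]
  ring

lemma pairEval_sub (p g : ℝ[X] × ℝ[X]) (z : ℝ × ℝ) :
    pairEval (p - g) z = pairEval p z - pairEval g z := by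
  simp only [pairEval, Prod.fst_sub, Prod.snd_sub, eval_sub]
  ring

lemma pairEval_smul (c : ℝ) (p : ℝ[X] × ℝ[X]) (z : ℝ × ℝ) :
    pairEval (c • p) z = c * pairEval p z := by
  simp only [pairEval, Prod.smul_fst, Prod.smul_snd, eval_smul, smul_eq_mul]
  ring

lemma pairEval_pairSq {q : ℝ[X]} (g : ℝ[X] × ℝ[X]) {z : ℝ × ℝ} (hz : z ∈ realPoints q) :
    pairEval (pairSq q g) z = pairEval g z ^ 2 := by
  have hz : z.2 ^ 2 + q.eval z.1 = 0 := hz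
  simp only [pairEval, pairSq, eval_sub, eval_mul, eval_pow, eval_ofNat]
  linear_combination (-g.2.eval z.1 ^ 2) * hz

lemma pairSq_sqrt_smul (q : ℝ[X]) {c : ℝ} (hc : 0 ≤ c) (g : ℝ[X] × ℝ[X]) :
    pairSq q (Real.sqrt c • g) = c • pairSq q g := by
  have h : (C (Real.sqrt c) : ℝ[X]) ^ 2 = C c := by rw [← C_pow, Real.sq_sqrt hc]
  ext1
  · simp only [pairSq, Prod.smul_fst, Prod.smul_snd, smul_eq_C_mul, ← h]
    ring
  · simp only [pairSq, Prod.smul_fst, Prod.smul_snd, smul_eq_C_mul, ← h]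
    ring

lemma exists_pairEval_ne_zero {q : ℝ[X]} (hindef : ∃ x : ℝ, q.eval x < 0) {g : ℝ[X] × ℝ[X]}
    (hg : g ≠ 0) : ∃ z ∈ realPoints q, pairEval g z ≠ 0 := by
  by_contra! h
  apply hg
  obtain ⟨x₀, hx₀⟩ := hindef
  have hinf : {x | q.eval x < 0}.Infinite :=
    infinite_of_mem_nhds x₀ (q.continuous.continuousAt.eventually (gt_mem_nhds hx₀))
  have key : ∀ x, q.eval x < 0 → g.1.eval x = 0 ∧ g.2.eval x = 0 := by
    intro x hx
    have hs : Real.sqrt (-q.eval x) ^ 2 = -q.eval x := Real.sq_sqrt (by linarith)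
    have hs0 : Real.sqrt (-q.eval x) ≠ 0 := (Real.sqrt_pos.2 (by linarith)).ne'
    have h1 := h (x, Real.sqrt (-q.eval x)) (by simp [realPoints, hs])
    have h2 := h (x, -Real.sqrt (-q.eval x)) (by simp [realPoints, hs])
    simp only [pairEval] at h1 h2
    refine ⟨by linarith, ?_⟩
    have : g.2.eval x * Real.sqrt (-q.eval x) = 0 := by linarith
    simpa [hs0] using this
  exact Prod.ext (eq_zero_of_infinite_isRoot _ (hinf.mono fun x hx => (key x hx).1))
    (eq_zero_of_infinite_isRoot _ (hinf.mono fun x hx => (key x hx).2))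

/-- The pairs in `pairLE k` whose square is bounded by a multiple of `p` on the real points. -/
def dominatedSubmodule (q : ℝ[X]) (p : ℝ[X] × ℝ[X]) (k : ℕ) : Submodule ℝ (ℝ[X] × ℝ[X]) where
  carrier := {g | g ∈ pairLE k ∧ SqDominated q p g}
  zero_mem' := ⟨zero_mem _, 0, by simp [pairEval]⟩
  add_mem' := by
    rintro g₁ g₂ ⟨h₁, c₁, hc₁⟩ ⟨h₂, c₂, hc₂⟩
    refine ⟨add_mem h₁ h₂, 2 * c₁ + 2 * c₂, fun z hz => ?_⟩
    rw [pairEval_add]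
    nlinarith [hc₁ z hz, hc₂ z hz, sq_nonneg (pairEval g₁ z - pairEval g₂ z)]
  smul_mem' := by
    rintro r g ⟨h, c, hc⟩
    refine ⟨Submodule.smul_mem _ r h, r ^ 2 * c, fun z hz => ?_⟩
    rw [pairEval_smul, mul_pow, mul_assoc]
    exact mul_le_mul_of_nonneg_left (hc z hz) (sq_nonneg r)

instance finiteDimensional_pairLE (k : ℕ) : FiniteDimensional ℝ (pairLE k) := by
  refine Module.Finite.iff_fg.2 (Submodule.FG.prod ?_ ?_)
  · exact Module.Finite.iff_fg.1 (finiteDimensional_degreeLT _)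
  · exact Module.Finite.iff_fg.1 (finiteDimensional_degreeLT _)

lemma dominatedSubmodule_le (q : ℝ[X]) (p : ℝ[X] × ℝ[X]) (k : ℕ) :
    dominatedSubmodule q p k ≤ pairLE k := fun _ h => h.1

instance finiteDimensional_dominatedSubmodule (q : ℝ[X]) (p : ℝ[X] × ℝ[X]) (k : ℕ) :
    FiniteDimensional ℝ (dominatedSubmodule q p k) :=
  Submodule.finiteDimensional_of_le (dominatedSubmodule_le q p k)

/-- A multiple of `s` can be subtracted from `p` in an optimal way. -/
lemma exists_maximal_sub {q : ℝ[X]} {p s : ℝ[X] × ℝ[X]} (hp : PairPsd q p) (hs : PairPsd q s)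
    (hs0 : ∃ z ∈ realPoints q, pairEval s z ≠ 0) :
    ∃ ε : ℝ, 0 ≤ ε ∧ PairPsd q (p - ε • s) ∧
      ¬ ∃ c : ℝ, ∀ z ∈ realPoints q, pairEval s z ≤ c * pairEval (p - ε • s) z := by
  obtain ⟨z₀, hz₀, hne⟩ := hs0
  have hpos : 0 < pairEval s z₀ := lt_of_le_of_ne (hs z₀ hz₀) hne.symm
  let I : Set ℝ := {ε | 0 ≤ ε ∧ ∀ z ∈ realPoints q, ε * pairEval s z ≤ pairEval p z}
  have hclosed : IsClosed I := by
    have : I = Set.Ici 0 ∩ ⋂ z ∈ realPoints q, {ε | ε * pairEval s z ≤ pairEval p z} := by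
      ext ε
      simp [I]
    rw [this]
    exact isClosed_Ici.inter (isClosed_biInter fun z _ =>
      isClosed_le (by fun_prop) continuous_const)
  have hcompact : IsCompact I :=
    (isCompact_Icc (a := 0) (b := pairEval p z₀ / pairEval s z₀)).of_isClosed_subset hclosed
      fun ε hε => ⟨hε.1, (le_div_iff₀ hpos).2 (hε.2 z₀ hz₀)⟩
  obtain ⟨ε, hε, hmax⟩ := hcompact.exists_isGreatest ⟨0, le_rfl, fun z hz => by simpa using hp z hz⟩
  have hpsd : PairPsd q (p - ε • s) := fun z hz => by
    rw [pairEval_sub, pairEval_smul]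
    linarith [hε.2 z hz]
  refine ⟨ε, hε.1, hpsd, ?_⟩
  rintro ⟨c, hc⟩
  have hc' : 0 < max c 1 := by positivity
  have : ε + 1 / max c 1 ∈ I := by
    refine ⟨by have := hε.1; positivity, fun z hz => ?_⟩
    have h1 : pairEval s z ≤ max c 1 * pairEval (p - ε • s) z :=
      (hc z hz).trans (mul_le_mul_of_nonneg_right (le_max_left _ _) (hpsd z hz))
    have h2 : 1 / max c 1 * pairEval s z ≤ pairEval (p - ε • s) z := by
      rw [one_div_mul_eq_div, div_le_iff₀ hc']
      linarith
    rw [pairEval_sub, pairEval_smul] at h2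
    linarith
  have h3 := hmax this
  have h4 : 0 < 1 / max c 1 := by positivity
  linarith

lemma exists_list_reduction {q : ℝ[X]} (hmonic : q.Monic) (hdeg : q.natDegree = 4)
    (hreg : ∀ u, q.eval u = 0 → q.derivative.eval u ≠ 0) (hindef : ∃ x : ℝ, q.eval x < 0)
    {p : ℝ[X] × ℝ[X]} {d : ℕ} (hp : PairPsd q p) (hpd : p ∈ pairLE d) :
    ∃ l : List (ℝ[X] × ℝ[X]), (∀ g ∈ l, g ∈ pairLE ((d + 1) / 2)) ∧
      PairPsd q (p - (l.map (pairSq q)).sum) ∧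
      (p - (l.map (pairSq q)).sum = 0 ∨ PairZerosReal q (p - (l.map (pairSq q)).sum)) ∧
      p - (l.map (pairSq q)).sum ∈ pairLE d := by
  induction hn : Module.finrank ℝ (dominatedSubmodule q p ((d + 1) / 2)) using
    Nat.strong_induction_on generalizing p with
  | _ n ih =>
    by_cases hdone : p = 0 ∨ PairZerosReal q p
    · exact ⟨[], by simp, by simpa using hp, by simpa using hdone, by simpa using hpd⟩
    push Not at hdone
    obtain ⟨g₁, hg₁, g₂, hg₂, hne, hdom₁, hdom₂, hsum⟩ :=
      exists_sqDominated hmonic hdeg hreg hindef hdone.1 hp hpd hdone.2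
    have hs : ∀ z ∈ realPoints q, pairEval (pairSq q g₁ + pairSq q g₂) z =
        pairEval g₁ z ^ 2 + pairEval g₂ z ^ 2 := fun z hz => by
      rw [pairEval_add, pairEval_pairSq _ hz, pairEval_pairSq _ hz]
    have hspsd : PairPsd q (pairSq q g₁ + pairSq q g₂) := fun z hz => by
      rw [hs z hz]
      positivity
    have hs0 : ∃ z ∈ realPoints q, pairEval (pairSq q g₁ + pairSq q g₂) z ≠ 0 := by
      obtain ⟨z, hz, h⟩ := exists_pairEval_ne_zero hindef hne
      refine ⟨z, hz, ?_⟩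
      rw [hs z hz]
      positivity
    obtain ⟨ε, hε, hpsd, hmax⟩ := exists_maximal_sub hp hspsd hs0
    have hle : dominatedSubmodule q (p - ε • (pairSq q g₁ + pairSq q g₂)) ((d + 1) / 2) ≤
        dominatedSubmodule q p ((d + 1) / 2) := by
      rintro g ⟨hg, c, hc⟩
      refine ⟨hg, |c|, fun z hz => (hc z hz).trans ?_⟩
      calc _ ≤ |c| * pairEval (p - ε • (pairSq q g₁ + pairSq q g₂)) z :=
            mul_le_mul_of_nonneg_right (le_abs_self c) (hpsd z hz)
        _ ≤ _ := by
            refine mul_le_mul_of_nonneg_left ?_ (abs_nonneg c)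
            rw [pairEval_sub, pairEval_smul]
            linarith [mul_nonneg hε (hspsd z hz)]
    have hlt := hle.lt_of_ne fun heq => hmax (by
      obtain ⟨-, c₁, hc₁⟩ := heq.ge (show g₁ ∈ _ from ⟨hg₁, hdom₁⟩)
      obtain ⟨-, c₂, hc₂⟩ := heq.ge (show g₂ ∈ _ from ⟨hg₂, hdom₂⟩)
      refine ⟨c₁ + c₂, fun z hz => ?_⟩
      rw [hs z hz, add_mul]
      exact add_le_add (hc₁ z hz) (hc₂ z hz))
    obtain ⟨l, hl, hres⟩ := ih _ (hn ▸ Submodule.finrank_lt_finrank_of_lt hlt) hpsd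
      (sub_mem hpd (Submodule.smul_mem _ ε hsum)) rfl
    refine ⟨Real.sqrt ε • g₁ :: Real.sqrt ε • g₂ :: l, ?_, ?_⟩
    · simp only [List.mem_cons, forall_eq_or_imp]
      exact ⟨Submodule.smul_mem _ _ hg₁, Submodule.smul_mem _ _ hg₂, hl⟩
    · have : p - ((Real.sqrt ε • g₁ :: Real.sqrt ε • g₂ :: l).map (pairSq q)).sum =
          p - ε • (pairSq q g₁ + pairSq q g₂) - (l.map (pairSq q)).sum := by
        simp only [List.map_cons, List.sum_cons, pairSq_sqrt_smul q hε, smul_add]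
        abel
      rw [this]
      exact hres

/-- The element `a(x) + b(x)·y` of the coordinate ring. -/
def ofPair (q : ℝ[X]) (p : ℝ[X] × ℝ[X]) : CurveRing q :=
  AdjoinRoot.mk (curvePoly q) (C p.1 + C p.2 * X)

lemma degree_curvePoly (q : ℝ[X]) : (curvePoly q).degree = 2 :=
  degree_X_pow_add_C (by norm_num) q

lemma curveRep_ofPair (q : ℝ[X]) (p : ℝ[X] × ℝ[X]) :
    curveRep q (ofPair q p) = C p.1 + C p.2 * X := by
  rw [curveRep, ofPair, AdjoinRoot.modByMonicHom_mk, modByMonic_eq_self_iff (curvePoly_monic q),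
    degree_curvePoly, add_comm]
  exact degree_linear_le.trans_lt (by norm_num)

@[simp]
lemma repA_ofPair (q : ℝ[X]) (p : ℝ[X] × ℝ[X]) : repA q (ofPair q p) = p.1 := by
  simp [repA, curveRep_ofPair]

@[simp]
lemma repB_ofPair (q : ℝ[X]) (p : ℝ[X] × ℝ[X]) : repB q (ofPair q p) = p.2 := by
  simp [repB, curveRep_ofPair, coeff_C]

lemma ofPair_rep (q : ℝ[X]) (f : CurveRing q) : ofPair q (repA q f, repB q f) = f := by
  have hdeg : (curveRep q f).degree ≤ 1 := by
    obtain ⟨r, rfl⟩ := AdjoinRoot.mk_surjective f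
    rw [curveRep, AdjoinRoot.modByMonicHom_mk]
    have := degree_modByMonic_lt r (curvePoly_monic q)
    rw [degree_curvePoly] at this
    exact Order.le_of_lt_succ this
  conv_rhs => rw [← AdjoinRoot.mk_leftInverse (curvePoly_monic q) f]
  change _ = AdjoinRoot.mk (curvePoly q) (curveRep q f)
  rw [eq_X_add_C_of_degree_le_one hdeg, add_comm]
  rfl

lemma ofPair_zero (q : ℝ[X]) : ofPair q 0 = 0 := by simp [ofPair]

lemma ofPair_add (q : ℝ[X]) (p g : ℝ[X] × ℝ[X]) :
    ofPair q (p + g) = ofPair q p + ofPair q g := by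
  simp only [ofPair, ← map_add]
  congr 1
  simp only [Prod.fst_add, Prod.snd_add, C_add]
  ring

lemma ofPair_sub (q : ℝ[X]) (p g : ℝ[X] × ℝ[X]) :
    ofPair q (p - g) = ofPair q p - ofPair q g := by
  rw [eq_sub_iff_add_eq, ← ofPair_add, sub_add_cancel]

lemma ofPair_pairSq (q : ℝ[X]) (g : ℝ[X] × ℝ[X]) : ofPair q (pairSq q g) = ofPair q g ^ 2 := by
  rw [ofPair, ofPair, ← map_pow, AdjoinRoot.mk_eq_mk]
  refine ⟨-C g.2 ^ 2, ?_⟩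
  simp only [pairSq, curvePoly, C_sub, C_mul, C_pow, map_ofNat]
  ring

lemma ofPair_ne_zero {q : ℝ[X]} {g : ℝ[X] × ℝ[X]} (hg : g ≠ 0) : ofPair q g ≠ 0 := by
  intro h
  rw [← ofPair_zero] at h
  exact hg (Prod.ext (by simpa using congrArg (repA q) h) (by simpa using congrArg (repB q) h))

lemma ofPair_sum_pairSq (q : ℝ[X]) (l : List (ℝ[X] × ℝ[X])) :
    ofPair q (l.map (pairSq q)).sum = (l.map fun g => ofPair q g ^ 2).sum := by
  induction l with
  | nil => simp [ofPair_zero]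
  | cons g l ih => simp [ofPair_add, ofPair_pairSq, ih]

lemma curveDelta_ofPair_le_iff {q : ℝ[X]} {p : ℝ[X] × ℝ[X]} {d : ℕ} :
    curveDelta q (ofPair q p) ≤ d ↔ p ∈ pairLE d := by
  rw [mem_pairLE, curveDelta, repA_ofPair, repB_ofPair]
  split_ifs with h <;> simp [h]

lemma sum_pairSq_filter_ne_zero (q : ℝ[X]) (l : List (ℝ[X] × ℝ[X]))
    [DecidablePred fun g : ℝ[X] × ℝ[X] => g ≠ 0] :
    ((l.filter (· ≠ 0)).map (pairSq q)).sum = (l.map (pairSq q)).sum := by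
  induction l with
  | nil => rfl
  | cons g l ih =>
    by_cases hg : g = 0
    · subst hg
      have : pairSq q 0 = 0 := by simp [pairSq]
      simpa [this] using ih
    · simpa [hg] using ih

lemma derivative_eval_ne_zero_of_squarefree_map {q : ℝ[X]}
    (hsep : Squarefree (q.map (algebraMap ℝ ℂ))) {u : ℝ} (hu : q.eval u = 0) :
    q.derivative.eval u ≠ 0 := by
  intro hu'
  have hq : q ≠ 0 := by
    rintro rfl
    simp at hsep
  have h2 : 2 ≤ q.rootMultiplicity u :=
    (one_lt_rootMultiplicity_iff_isRoot hq).2 ⟨hu, hu'⟩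
  have hdvd := Polynomial.map_dvd (algebraMap ℝ ℂ) ((le_rootMultiplicity_iff hq).1 h2)
  rw [Polynomial.map_pow, pow_two, Polynomial.map_sub, map_X, map_C] at hdvd
  exact not_isUnit_X_sub_C _ (hsep _ hdvd)

/-- Proposition 2.6 / `keycor`: reduction of a psd element to one
with only real zeros, with control of the `δ`-degrees. -/
theorem psd_reduction_to_real_zeros
    (q : Polynomial ℝ) (hmonic : q.Monic) (hdeg : q.natDegree = 4)
    (hsep : Squarefree (q.map (algebraMap ℝ ℂ)))
    (hindef : ∃ x : ℝ, q.eval x < 0)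
    (f : CurveRing q) (hf0 : f ≠ 0) (hf : IsPsd q f) :
    ∃ (r : ℕ) (g : Fin r → CurveRing q), (∀ i, g i ≠ 0) ∧
      IsPsd q (f - ∑ i, g i ^ 2) ∧
      (f - ∑ i, g i ^ 2 = 0 ∨ AllZerosReal q (f - ∑ i, g i ^ 2)) ∧
      (∀ i, curveDelta q (g i) ≤ (curveDelta q f + 1) / 2) ∧
      (f - ∑ i, g i ^ 2 ≠ 0 → curveDelta q (f - ∑ i, g i ^ 2) ≤ curveDelta q f) := by
  classical
  obtain ⟨p, rfl⟩ : ∃ p, f = ofPair q p := ⟨_, (ofPair_rep q f).symm⟩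
  have hp : PairPsd q p := fun z hz => by
    simpa [pairEval] using hf z.1 z.2 hz
  obtain ⟨l, hl, hpsd, hzero, hle⟩ := exists_list_reduction hmonic hdeg
    (fun u hu => derivative_eval_ne_zero_of_squarefree_map hsep hu) hindef hp
    (curveDelta_ofPair_le_iff.1 le_rfl)
  rw [← sum_pairSq_filter_ne_zero] at hpsd hzero hle
  have hl' : ∀ g ∈ l.filter (· ≠ 0), g ≠ 0 ∧ g ∈ pairLE ((curveDelta q (ofPair q p) + 1) / 2) := by
    intro g hg
    rw [List.mem_filter] at hg
    exact ⟨by simpa using hg.2, hl g hg.1⟩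
  generalize l.filter (· ≠ 0) = l at *
  have hsum : ofPair q p - ∑ i, ofPair q (l.get i) ^ 2 =
      ofPair q (p - (l.map (pairSq q)).sum) := by
    rw [ofPair_sub, ofPair_sum_pairSq, ← Fin.sum_univ_fun_getElem]
    rfl
  refine ⟨l.length, fun i => ofPair q (l.get i),
    fun i => ofPair_ne_zero (hl' _ (l.get_mem i)).1, ?_, ?_,
    fun i => curveDelta_ofPair_le_iff.2 (hl' _ (l.get_mem i)).2, fun _ => ?_⟩
  · rw [hsum]
    intro u v huv
    rw [repA_ofPair, repB_ofPair]; exact hpsd (u, v) huv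
  · rw [hsum]
    refine hzero.imp (fun h => by rw [h, ofPair_zero]) fun h u v => ?_
    rw [repA_ofPair, repB_ofPair]
    exact h u v
  · rw [hsum]
    exact curveDelta_ofPair_le_iff.2 hle

end
end

section
/- For every nonzero psd element f of ℝ[C] all of whose zeros on C(ℂ) are real, there exist g ∈ {1, x − α, β − x, (x − α)(β − x)} (viewed in ℝ[C]) and w ∈ ℝ(C) with f = g·w². Moreover, the square classes in ℝ(C)*/ℝ(C)*² of 1, x − α, β − x and (x − α)(β − x) are pairwise distinct; i.e., the subgroup of ℝ(C)*/ℝ(C)*² generated by the classes of all such f has order exactly four and is generated by the classes of x − α and β − x. -/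
open Polynomial

noncomputable section

/-- The four candidate square-class representatives `1, x−α, β−x, (x−α)(β−x)` in `ℝ[C]`. -/
def sqClassReps (q : Polynomial ℝ) (α β : ℝ) : Fin 4 → CurveRing q :=
  ![1, AdjoinRoot.of (curvePoly q) (X - C α),
    AdjoinRoot.of (curvePoly q) (C β - X),
    AdjoinRoot.of (curvePoly q) ((X - C α) * (C β - X))]

lemma klein_four_reps_ne_mul_sq {K : Type*} [Field K] {x z : K} (hx : ∀ w, x ≠ w ^ 2)
    (hz : ∀ w, z ≠ w ^ 2) (hxz : ∀ w, x * z ≠ w ^ 2) {i j : Fin 4} (hij : i ≠ j) (w : K) :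
    ![1, x, z, x * z] i ≠ ![1, x, z, x * z] j * w ^ 2 := by
  intro hw
  have hx0 : x ≠ 0 := by simpa using hx 0
  have hz0 : z ≠ 0 := by simpa using hz 0
  fin_cases i <;> fin_cases j <;>
  simp only [Fin.zero_eta, Fin.mk_one, Fin.reduceFinMk, Matrix.cons_val,
    ne_eq, not_true_eq_false] at hw hij
  · exact hx (x * w) (by linear_combination x * hw)
  · exact hz (z * w) (by linear_combination z * hw)
  · exact hxz (x * z * w) (by linear_combination x * z * hw)
  · exact hx w (by linear_combination hw)
  · exact hxz (z * w) (by linear_combination z * hw)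
  · exact hz (z * w) (mul_left_cancel₀ hx0 (by linear_combination z * hw))
  · exact hz w (by linear_combination hw)
  · exact hxz (x * w) (by linear_combination x * hw)
  · exact hx (x * w) (mul_left_cancel₀ hz0 (by linear_combination x * hw))
  · exact hxz w (by linear_combination hw)
  · exact hz w (mul_left_cancel₀ hx0 (by linear_combination hw))
  · exact hx w (mul_left_cancel₀ hz0 (by linear_combination hw))


namespace Polynomial

lemma exists_eq_squarefree_mul_sq {K : Type*} [Field K] {h : K[X]} (h0 : h ≠ 0) :
    ∃ e t : K[X], h = e * t ^ 2 ∧ Squarefree e := by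
  induction hn : h.natDegree using Nat.strong_induction_on generalizing h with
  | _ n ih =>
    by_cases hs : Squarefree h
    · exact ⟨h, 1, by ring, hs⟩
    · simp only [Squarefree, not_forall] at hs
      obtain ⟨x, ⟨k, rfl⟩, hx⟩ := hs
      have hx0 : x ≠ 0 := by rintro rfl; simp at h0
      have hk0 : k ≠ 0 := by rintro rfl; simp at h0
      have hxd : 0 < x.natDegree := natDegree_pos_iff_degree_pos.2 (degree_pos_of_ne_zero_of_nonunit hx0 hx)
      have hlt : k.natDegree < n := by
        rw [natDegree_mul (mul_ne_zero hx0 hx0) hk0, natDegree_mul hx0 hx0] at hn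
        omega
      obtain ⟨e, t, rfl, he⟩ := ih _ hlt hk0 rfl
      exact ⟨e, x * t, by ring, he⟩

lemma eq_zero_of_squarefree_mul_sq_eq_sq {K : Type*} [Field K] {p B D : K[X]}
    (hp : Squarefree p) (hu : ¬ IsUnit p) (h : p * B ^ 2 = D ^ 2) : B = 0 := by
  by_contra hB
  obtain ⟨E, rfl⟩ := (IsIntegrallyClosed.pow_dvd_pow_iff two_ne_zero).1
    (show B ^ 2 ∣ D ^ 2 from ⟨p, by rw [← h]; ring⟩)
  have hE : p = E * E := mul_left_cancel₀ (pow_ne_zero 2 hB) (by linear_combination h)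
  have := hp E ⟨1, by rw [hE]; ring⟩
  exact hu (hE ▸ this.mul this)

lemma dvd_of_squarefree_of_forall_prime_dvd {K : Type*} [Field K] {e q : K[X]}
    (he : Squarefree e) (hq : q ≠ 0) (h : ∀ π, Prime π → π ∣ e → π ∣ q) : e ∣ q := by
  classical
  open UniqueFactorizationMonoid in
  rw [dvd_iff_normalizedFactors_le_normalizedFactors he.ne_zero hq,
    Multiset.le_iff_subset ((squarefree_iff_nodup_normalizedFactors he.ne_zero).1 he)]
  intro π hπ
  rw [UniqueFactorizationMonoid.mem_normalizedFactors_iff' he.ne_zero] at hπ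
  rw [UniqueFactorizationMonoid.mem_normalizedFactors_iff' hq]
  exact ⟨hπ.1, hπ.2.1, h π hπ.1.prime hπ.2.2⟩

lemma prime_dvd_of_squarefree_mul_sq_mul_eq {K : Type*} [Field K] {π e t m q b : K[X]}
    (hπ : Prime π) (he : Squarefree e) (hπe : π ∣ e) (ht : t ≠ 0) (hq : ¬ π ∣ q)
    (h : e * t ^ 2 * m = q * b ^ 2) : π ∣ m := by
  by_cases hm : m = 0
  · simp [hm]
  obtain ⟨e₂, t₂, rfl, he₂⟩ := exists_eq_squarefree_mul_sq hm
  have ht₂ : t₂ ≠ 0 := by rintro rfl; simp at hm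
  have hsq : (t * t₂) ^ 2 * (e * e₂ * q) = (q * b) ^ 2 := by linear_combination q * h
  obtain ⟨E, hE⟩ := (IsIntegrallyClosed.pow_dvd_pow_iff two_ne_zero).1 ⟨_, hsq.symm⟩
  have hE2 : e * e₂ * q = E ^ 2 := by
    apply mul_left_cancel₀ (pow_ne_zero 2 (mul_ne_zero ht ht₂))
    rw [hsq, hE]; ring
  obtain ⟨e', rfl⟩ := hπe
  have hπE : π ∣ E := hπ.dvd_of_dvd_pow ⟨e' * e₂ * q, by rw [← hE2]; ring⟩
  obtain ⟨E', rfl⟩ := hπE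
  have h1 : e' * e₂ * q = π * E' ^ 2 := mul_left_cancel₀ hπ.ne_zero (by linear_combination hE2)
  have he' : ¬ π ∣ e' := by
    rintro ⟨k, rfl⟩
    exact hπ.not_isUnit (he π ⟨k, by ring⟩)
  have h2 : π ∣ e' * e₂ * q := ⟨_, h1⟩
  exact (((hπ.dvd_or_dvd h2).resolve_right hq |> hπ.dvd_or_dvd).resolve_left he').mul_right _

lemma eval_nonneg_of_mul_sq {e t : ℝ[X]} (ht : t ≠ 0) {U : Set ℝ} (hU : IsOpen U)
    (h : ∀ x ∈ U, 0 ≤ (e * t ^ 2).eval x) {x : ℝ} (hx : x ∈ U) : 0 ≤ e.eval x := by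
  by_contra! hneg
  have hV : IsOpen (U ∩ {y | e.eval y < 0}) :=
    hU.inter (isOpen_lt e.continuous continuous_const)
  refine ht (eq_zero_of_infinite_isRoot t
    ((infinite_of_mem_nhds x (hV.mem_nhds ⟨hx, hneg⟩)).mono ?_))
  rintro y ⟨hyU, hy⟩
  have := h y hyU
  simp only [eval_mul, eval_pow] at this
  by_contra hty
  have := mul_neg_of_neg_of_pos hy (pow_two_pos_of_ne_zero hty)
  linarith

lemma eval_ne_zero_of_squarefree_of_nonneg {e : ℝ[X]} (he : Squarefree e) {U : Set ℝ}
    (hU : IsOpen U) (h : ∀ x ∈ U, 0 ≤ e.eval x) {u : ℝ} (hu : u ∈ U) : e.eval u ≠ 0 := by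
  intro h0
  have hmin : IsLocalMin (fun x => e.eval x) u := by
    filter_upwards [hU.mem_nhds hu] with x hx
    simpa only [h0] using h x hx
  have hd := hmin.deriv_eq_zero
  obtain ⟨k, rfl⟩ := dvd_iff_isRoot.2 h0
  rw [Polynomial.deriv] at hd
  have hk : k.eval u = 0 := by simpa [derivative_mul] using hd
  obtain ⟨l, rfl⟩ := dvd_iff_isRoot.2 hk
  exact not_isUnit_X_sub_C u (he _ ⟨l, by ring⟩)

lemma exists_sq_of_nonneg_of_roots_real {N : ℝ[X]} (h : ∀ x, 0 ≤ N.eval x)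
    (hr : ∀ u : ℂ, (N.map (algebraMap ℝ ℂ)).eval u = 0 → u.im = 0) : ∃ s, N = s ^ 2 := by
  by_cases hN : N = 0
  · exact ⟨0, by simp [hN]⟩
  obtain ⟨e, t, rfl, he⟩ := exists_eq_squarefree_mul_sq hN
  have ht : t ≠ 0 := by rintro rfl; simp at hN
  have hnn : ∀ x ∈ Set.univ, 0 ≤ e.eval x := fun x hx =>
    eval_nonneg_of_mul_sq ht isOpen_univ (fun y _ => h y) hx
  have hdeg : e.degree ≤ 0 := by
    by_contra! hd
    obtain ⟨u, hu⟩ := IsAlgClosed.exists_root (e.map (algebraMap ℝ ℂ))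
      (by rw [degree_map]; exact hd.ne')
    have him := hr u (by simp [show (e.map (algebraMap ℝ ℂ)).eval u = 0 from hu])
    obtain ⟨r, rfl⟩ : ∃ r : ℝ, (r : ℂ) = u := ⟨u.re, by apply Complex.ext <;> simp [him]⟩
    refine eval_ne_zero_of_squarefree_of_nonneg he isOpen_univ hnn (Set.mem_univ r) ?_
    have hu' : (e.map (algebraMap ℝ ℂ)).eval (algebraMap ℝ ℂ r) = 0 := hu
    rw [eval_map_apply] at hu'
    simpa using hu'
  rw [eq_C_of_degree_le_zero hdeg] at hnn ⊢
  have hc : 0 ≤ e.coeff 0 := by simpa using hnn 0 trivial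
  refine ⟨C (√(e.coeff 0)) * t, ?_⟩
  rw [mul_pow, ← C_pow, Real.sq_sqrt hc]

lemma exists_root_gt_of_eval_neg {q : ℝ[X]} (hm : q.Monic) (hd : 0 < q.natDegree) {x : ℝ}
    (hx : q.eval x < 0) : ∃ r, x < r ∧ q.eval r = 0 := by
  have ht := q.tendsto_atTop_of_leadingCoeff_nonneg (natDegree_pos_iff_degree_pos.1 hd)
    (by rw [hm.leadingCoeff]; norm_num)
  obtain ⟨y, hy, hxy⟩ := ((ht.eventually_gt_atTop 0).and (Filter.eventually_gt_atTop x)).exists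
  obtain ⟨r, hr, hr0⟩ := intermediate_value_Icc hxy.le q.continuous.continuousOn ⟨hx.le, hy.le⟩
  refine ⟨r, lt_of_le_of_ne hr.1 ?_, hr0⟩
  rintro rfl
  exact hx.ne hr0

lemma exists_root_lt_of_eval_neg {q : ℝ[X]} (hm : q.Monic) (hd : 0 < q.natDegree)
    (he : Even q.natDegree) {x : ℝ} (hx : q.eval x < 0) : ∃ r, r < x ∧ q.eval r = 0 := by
  have hm' : (q.comp (-X)).Monic := by
    rw [Monic, leadingCoeff_comp (by simp)]
    simp [hm.leadingCoeff, he.neg_one_pow]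
  obtain ⟨r, hr, hr0⟩ := exists_root_gt_of_eval_neg hm' (by simpa [natDegree_comp] using hd)
    (x := -x) (by simpa [eval_comp] using hx)
  exact ⟨-r, by linarith, by simpa [eval_comp] using hr0⟩

end Polynomial

namespace CurveRing

variable {q : ℝ[X]}

local notation "ι" => AdjoinRoot.of (curvePoly q)

local notation "𝐲" => AdjoinRoot.root (curvePoly q)

lemma root_sq : 𝐲 ^ 2 = - ι q := by
  have h : AdjoinRoot.mk (curvePoly q) (X ^ 2 + C q) = 0 := AdjoinRoot.mk_self
  rw [map_add, map_pow, AdjoinRoot.mk_X, AdjoinRoot.mk_C] at h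
  exact eq_neg_of_add_eq_zero_left h

lemma natDegree_curvePoly : (curvePoly q).natDegree = 2 := natDegree_X_pow_add_C

lemma eq_repA_add_repB_mul_root (f : CurveRing q) :
    f = ι (repA q f) + ι (repB q f) * 𝐲 := by
  have hdeg : (curveRep q f).natDegree < 2 := by
    obtain ⟨g, rfl⟩ := AdjoinRoot.mk_surjective f
    rw [curveRep, AdjoinRoot.modByMonicHom_mk, ← natDegree_curvePoly (q := q)]
    exact natDegree_modByMonic_lt _ (curvePoly_monic q)
      (fun h => by simpa [h] using natDegree_curvePoly (q := q))
  have h := AdjoinRoot.mk_leftInverse (curvePoly_monic q) f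
  conv_lhs => rw [← h]
  change AdjoinRoot.mk _ (curveRep q f) = _
  rw [eq_X_add_C_of_natDegree_le_one (p := curveRep q f) (by omega)]
  simp [repA, repB, add_comm]

lemma eq_zero_of_add_mul_root_eq_zero {A B : ℝ[X]} (h : ι A + ι B * 𝐲 = 0) :
    A = 0 ∧ B = 0 := by
  have h1 : AdjoinRoot.mk (curvePoly q) (C B * X + C A) = 0 := by
    rw [← h]; simp [add_comm]
  rw [AdjoinRoot.mk_eq_zero] at h1
  have h2 : C B * X + C A = 0 := by
    apply eq_zero_of_dvd_of_natDegree_lt h1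
    rw [natDegree_curvePoly]
    exact lt_of_le_of_lt natDegree_linear_le one_lt_two
  exact ⟨by simpa using congrArg (coeff · 0) h2, by simpa using congrArg (coeff · 1) h2⟩

lemma of_injective : Function.Injective ι := by
  rw [injective_iff_map_eq_zero]
  intro A hA
  exact (eq_zero_of_add_mul_root_eq_zero (A := A) (B := 0) (by simpa using hA)).1

lemma isDomain (hq : Squarefree q) (hu : ¬ IsUnit q) : IsDomain (CurveRing q) := by
  apply AdjoinRoot.isDomain_of_prime
  apply Irreducible.prime
  rw [(curvePoly_monic q).irreducible_iff_roots_eq_zero_of_degree_le_three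
    (by rw [natDegree_curvePoly]) (by rw [natDegree_curvePoly]; norm_num)]
  refine Multiset.eq_zero_of_forall_notMem fun r hr => ?_
  have h : r ^ 2 + q = 0 := by simpa [curvePoly] using (mem_roots'.1 hr).2
  have hr' := hq r ⟨-1, by linear_combination h⟩
  apply hu
  rw [show q = -(r * r) by linear_combination h]
  exact (hr'.mul hr').neg

/-- A proper factor of `q` is not a square in the function field of the curve. -/
lemma mul_sq_ne_sq (hq : Squarefree q) {k m : ℝ[X]} (hkm : q = k * m) (hk : ¬ IsUnit k)
    (hm : ¬ IsUnit m) {d n : CurveRing q} (hd : d ≠ 0) : ι k * d ^ 2 ≠ n ^ 2 := by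
  have := isDomain hq (fun h => hk (isUnit_of_mul_isUnit_left (hkm ▸ h)))
  intro h
  set a := repA q d
  set b := repB q d
  have hda : d = ι a + ι b * 𝐲 := eq_repA_add_repB_mul_root d
  have hnorm : d * (ι a - ι b * 𝐲) = ι (a ^ 2 + q * b ^ 2) := by
    rw [hda]; simp only [map_add, map_mul, map_pow]
    linear_combination - ι b ^ 2 * root_sq (q := q)
  have hconj : ι a - ι b * 𝐲 ≠ 0 := by
    intro h0
    obtain ⟨ha, hb⟩ := eq_zero_of_add_mul_root_eq_zero (A := a) (B := -b)
      (by rw [map_neg]; linear_combination h0)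
    exact hd (by rw [hda, ha, neg_eq_zero.1 hb]; simp)
  set D := a ^ 2 + q * b ^ 2
  have hD : D ≠ 0 := by
    intro h0
    rw [h0, map_zero] at hnorm
    exact (mul_ne_zero hd hconj) hnorm
  set w := n * (ι a - ι b * 𝐲)
  set A := repA q w
  set B := repB q w
  have hw : w = ι A + ι B * 𝐲 := eq_repA_add_repB_mul_root w
  have hkD : ι (k * D ^ 2) = w ^ 2 := by
    rw [map_mul, map_pow, ← hnorm]
    linear_combination (ι a - ι b * 𝐲) ^ 2 * h
  have hcoeff := eq_zero_of_add_mul_root_eq_zero (q := q)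
    (A := k * D ^ 2 - A ^ 2 + q * B ^ 2) (B := -(2 * A * B)) (by
      rw [hw] at hkD
      simp only [map_add, map_mul, map_pow, map_sub, map_neg, map_ofNat] at hkD ⊢
      linear_combination hkD + ι B ^ 2 * root_sq (q := q))
  obtain ⟨h1, h2⟩ := hcoeff
  have hks : Squarefree k := hq.squarefree_of_dvd ⟨m, hkm⟩
  have hms : Squarefree m := hq.squarefree_of_dvd ⟨k, by rw [hkm]; ring⟩
  rcases mul_eq_zero.1 (neg_eq_zero.1 h2) with hA | hB
  · have hA : A = 0 := by simpa using hA
    have h3 : m * B ^ 2 * (-1) = D ^ 2 := by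
      apply mul_left_cancel₀ hks.ne_zero
      linear_combination B ^ 2 * hkm - h1 - A * hA
    have hms' : Squarefree (-m) := hms.squarefree_of_dvd (by simp)
    have hB := eq_zero_of_squarefree_mul_sq_eq_sq hms' (by simpa using hm)
      (show -m * B ^ 2 = D ^ 2 by linear_combination h3)
    rw [hB] at h3
    exact hD (by simpa using h3.symm)
  · exact hD (eq_zero_of_squarefree_mul_sq_eq_sq hks hk
      (show k * D ^ 2 = A ^ 2 by linear_combination h1 - q * B * hB))

/-- Up to nonzero square factors, `r` is one of the four representatives. -/
def HasSqClassRep (q : ℝ[X]) (α β : ℝ) (r : ℝ[X]) : Prop :=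
  ∃ (i : Fin 4) (D : ℝ[X]) (W : CurveRing q), D ≠ 0 ∧
    AdjoinRoot.of (curvePoly q) (r * D ^ 2) = sqClassReps q α β i * W ^ 2

namespace HasSqClassRep

variable {α β : ℝ} {r p : ℝ[X]}

lemma mul_sq (h : HasSqClassRep q α β r) (t : ℝ[X]) : HasSqClassRep q α β (r * t ^ 2) := by
  obtain ⟨i, D, W, hD, h⟩ := h
  refine ⟨i, D, W * ι t, hD, ?_⟩
  simp only [map_mul, map_pow] at h ⊢
  linear_combination ι t ^ 2 * h

lemma mul_C (h : HasSqClassRep q α β r) {c : ℝ} (hc : 0 ≤ c) :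
    HasSqClassRep q α β (r * C c) := by
  rw [← Real.sq_sqrt hc, C_pow]
  exact h.mul_sq _

lemma mul_cofactor (h : HasSqClassRep q α β r) (hp : q = (X - C α) * (X - C β) * p) :
    HasSqClassRep q α β (r * p) := by
  obtain ⟨i, D, W, hD, h⟩ := h
  have hα : X - C α ≠ 0 := X_sub_C_ne_zero α
  have hβ : X - C β ≠ 0 := X_sub_C_ne_zero β
  have hy := root_sq (q := q)
  rw [congrArg ι hp] at hy
  refine ⟨i.rev, D * ((X - C α) * (X - C β)), W * 𝐲 *
    ![1, ι (X - C α), ι (X - C β), ι ((X - C α) * (X - C β))] i,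
    mul_ne_zero hD (mul_ne_zero hα hβ), ?_⟩
  have hneg : (C β - X : ℝ[X]) = -(X - C β) := by ring
  have e0 : Fin.rev (0 : Fin 4) = 3 := rfl
  have e1 : Fin.rev (1 : Fin 4) = 2 := rfl
  have e2 : Fin.rev (2 : Fin 4) = 1 := rfl
  have e3 : Fin.rev (3 : Fin 4) = 0 := rfl
  simp only [sqClassReps, hneg] at h ⊢
  generalize X - C α = x at *
  generalize X - C β = z at *
  fin_cases i <;>
  simp only [Fin.zero_eta, Fin.mk_one, Fin.reduceFinMk, e0, e1, e2, e3, Matrix.cons_val,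
    map_mul, map_pow, map_neg] at h hy ⊢ <;>
  simp only [mul_pow, hy] <;>
  linear_combination ι p * ι x ^ 2 * ι z ^ 2 * h

end HasSqClassRep

end CurveRing

section SquareClasses

open CurveRing

variable {q : ℝ[X]} {α β : ℝ}

lemma hasSqClassRep_of_dvd (hmonic : q.Monic) (hdeg : q.natDegree = 4) (hsq : Squarefree q)
    (hindef : ∃ x : ℝ, q.eval x < 0) (hαβ : ∀ x : ℝ, q.eval x = 0 → α ≤ x ∧ x ≤ β)
    {p : ℝ[X]} (hp : q = (X - C α) * (X - C β) * p) {e : ℝ[X]} (he : e ∣ q)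
    (hnn : ∀ x, q.eval x < 0 → 0 ≤ e.eval x) : HasSqClassRep q α β e := by
  have hbd : ∀ x, q.eval x < 0 → α < x ∧ x < β := fun x hx => by
    obtain ⟨r, hr, hr0⟩ := exists_root_gt_of_eval_neg hmonic (by omega) hx
    obtain ⟨l, hl, hl0⟩ := exists_root_lt_of_eval_neg hmonic (by omega) (by rw [hdeg]; decide) hx
    exact ⟨(hαβ l hl0).1.trans_lt hl, hr.trans_le (hαβ r hr0).2⟩
  have hpm : p.Monic := by
    rw [hp] at hmonic
    exact ((monic_X_sub_C α).mul (monic_X_sub_C β)).of_mul_monic_left hmonic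
  have hpd : p.natDegree = 2 := by
    rw [hp, ((monic_X_sub_C α).mul (monic_X_sub_C β)).natDegree_mul hpm,
      (monic_X_sub_C α).natDegree_mul (monic_X_sub_C β)] at hdeg
    simp only [natDegree_X_sub_C] at hdeg
    omega
  have hπα : Prime (X - C α) := prime_X_sub_C α
  have hπβ : Prime (C β - X) := by
    rw [← neg_sub]; exact (prime_X_sub_C β).neg
  have hneg : q = (X - C α) * ((C β - X) * -p) := by rw [hp]; ring
  have hsplit_α : ∃ g₁ e₀, (g₁ = 1 ∨ g₁ = X - C α) ∧ e = g₁ * e₀ ∧ e₀ ∣ (C β - X) * -p := by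
    rw [hneg] at he
    rcases hπα.left_dvd_or_dvd_right_of_dvd_mul he with ⟨k, rfl⟩ | h
    · exact ⟨_, k, Or.inr rfl, rfl, (mul_dvd_mul_iff_left hπα.ne_zero).1 he⟩
    · exact ⟨1, e, Or.inl rfl, by simp, h⟩
  obtain ⟨g₁, e₀, hg₁, he₀, hdvd⟩ := hsplit_α
  have hsplit_β : ∃ g₂ e₁, (g₂ = 1 ∨ g₂ = C β - X) ∧ e₀ = g₂ * e₁ ∧ e₁ ∣ p := by
    rcases hπβ.left_dvd_or_dvd_right_of_dvd_mul hdvd with ⟨k, rfl⟩ | h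
    · exact ⟨_, k, Or.inr rfl, rfl,
        (dvd_neg.1 ((mul_dvd_mul_iff_left hπβ.ne_zero).1 hdvd))⟩
    · exact ⟨1, e₀, Or.inl rfl, by simp, dvd_neg.1 h⟩
  obtain ⟨g₂, e₁, hg₂, rfl, e₂, hpe⟩ := hsplit_β
  have hG : HasSqClassRep q α β (g₁ * g₂) := by
    rcases hg₁ with rfl | rfl <;> rcases hg₂ with rfl | rfl
    · exact ⟨0, 1, 1, one_ne_zero, by simp [sqClassReps]⟩
    · exact ⟨2, 1, 1, one_ne_zero, by simp [sqClassReps]⟩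
    · exact ⟨1, 1, 1, one_ne_zero, by simp [sqClassReps]⟩
    · exact ⟨3, 1, 1, one_ne_zero, by simp [sqClassReps]⟩
  have hnn₁ : ∀ x, q.eval x < 0 → 0 ≤ e₁.eval x := fun x hx => by
    obtain ⟨h1, h2⟩ := hbd x hx
    have hx' := hnn x hx
    rw [he₀, eval_mul, eval_mul] at hx'
    have p1 : 0 < g₁.eval x := by rcases hg₁ with rfl | rfl <;> simp [h1]
    have p2 : 0 < g₂.eval x := by rcases hg₂ with rfl | rfl <;> simp [h2]
    exact nonneg_of_mul_nonneg_right (nonneg_of_mul_nonneg_right hx' p1) p2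
  obtain ⟨x₀, hx₀⟩ := hindef
  have hp0 : p ≠ 0 := hpm.ne_zero
  have he₁0 : e₁ ≠ 0 := by rintro rfl; simp [hpe] at hp0
  have he₂0 : e₂ ≠ 0 := by rintro rfl; simp [hpe] at hp0
  have hsum : e₁.natDegree + e₂.natDegree = 2 := by
    rw [← natDegree_mul he₁0 he₂0, ← hpe, hpd]
  rw [he₀, ← mul_assoc]
  have hcases : e₁.natDegree = 0 ∨ e₂.natDegree = 0 ∨
      (e₁.natDegree = 1 ∧ e₂.natDegree = 1) := by omega
  rcases hcases with h | h | ⟨h1, h2⟩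
  · obtain ⟨c, rfl⟩ := natDegree_eq_zero.1 h
    exact hG.mul_C (by simpa using hnn₁ x₀ hx₀)
  · obtain ⟨c, rfl⟩ := natDegree_eq_zero.1 h
    have hc0 : c ≠ 0 := by rintro rfl; simp at he₂0
    have hpx : 0 < p.eval x₀ := by
      obtain ⟨h1, h2⟩ := hbd x₀ hx₀
      have hx := hx₀
      rw [hp] at hx
      simp only [eval_mul, eval_sub, eval_X, eval_C] at hx
      have : (x₀ - α) * (x₀ - β) < 0 := mul_neg_of_pos_of_neg (by linarith) (by linarith)
      by_contra! hle
      have := mul_nonneg_of_nonpos_of_nonpos this.le hle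
      linarith
    have hc : 0 < c := by
      have := hnn₁ x₀ hx₀
      rw [hpe, eval_mul, eval_C] at hpx
      exact pos_of_mul_pos_right hpx this
    have he₁ : e₁ = p * C c⁻¹ := by
      rw [hpe, mul_assoc, ← C_mul, mul_inv_cancel₀ hc0]; simp
    rw [he₁, ← mul_assoc]
    exact (hG.mul_cofactor hp).mul_C (inv_nonneg.2 hc.le)
  · exfalso
    obtain ⟨γ, hγ⟩ := exists_root_of_degree_eq_one (degree_eq_iff_natDegree_eq he₁0 |>.2 h1)
    obtain ⟨δ, hδ⟩ := exists_root_of_degree_eq_one (degree_eq_iff_natDegree_eq he₂0 |>.2 h2)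
    obtain ⟨k₁, rfl⟩ := dvd_iff_isRoot.2 hγ
    obtain ⟨k₂, rfl⟩ := dvd_iff_isRoot.2 hδ
    have hk₁ : k₁ ≠ 0 := right_ne_zero_of_mul he₁0
    have hk₂ : k₂ ≠ 0 := right_ne_zero_of_mul he₂0
    rw [natDegree_mul (X_sub_C_ne_zero _) hk₁, natDegree_X_sub_C] at h1
    rw [natDegree_mul (X_sub_C_ne_zero _) hk₂, natDegree_X_sub_C] at h2
    obtain ⟨c₁, rfl⟩ := natDegree_eq_zero.1 (show k₁.natDegree = 0 by omega)
    obtain ⟨c₂, rfl⟩ := natDegree_eq_zero.1 (show k₂.natDegree = 0 by omega)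
    have hc : c₁ * c₂ = 1 := by
      have := hpm.leadingCoeff
      rw [hpe] at this
      simpa using this
    have hqe : ∀ x, q.eval x = (x - α) * (x - β) * ((x - γ) * (x - δ)) := fun x => by
      rw [hp, hpe]
      simp only [eval_mul, eval_sub, eval_X, eval_C]
      linear_combination (x - α) * (x - β) * ((x - γ) * (x - δ)) * hc
    obtain ⟨hγ1, hγ2⟩ := hαβ γ (by rw [hqe]; ring)
    obtain ⟨hδ1, hδ2⟩ := hαβ δ (by rw [hqe]; ring)
    have hne : ∀ z, ¬ (X - C z) * (X - C z) ∣ q := fun z hz =>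
      not_isUnit_X_sub_C z (hsq _ hz)
    have hγα : α < γ := lt_of_le_of_ne hγ1 (by
      rintro rfl; exact hne α ⟨(X - C β) * (C c₁ * ((X - C δ) * C c₂)), by rw [hp, hpe]; ring⟩)
    have hγβ : γ < β := lt_of_le_of_ne hγ2 (by
      rintro rfl; exact hne γ ⟨(X - C α) * (C c₁ * ((X - C δ) * C c₂)), by rw [hp, hpe]; ring⟩)
    have hδα : α < δ := lt_of_le_of_ne hδ1 (by
      rintro rfl; exact hne α ⟨(X - C β) * (C c₂ * ((X - C γ) * C c₁)), by rw [hp, hpe]; ring⟩)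
    have hδβ : δ < β := lt_of_le_of_ne hδ2 (by
      rintro rfl; exact hne δ ⟨(X - C α) * (C c₂ * ((X - C γ) * C c₁)), by rw [hp, hpe]; ring⟩)
    obtain ⟨x, hx1, hx2⟩ := exists_between (lt_min hγα hδα)
    obtain ⟨hxγ, hxδ⟩ := lt_min_iff.1 hx2
    obtain ⟨z, hz1, hz2⟩ := exists_between (max_lt hγβ hδβ)
    obtain ⟨hzγ, hzδ⟩ := max_lt_iff.1 hz1
    have hex := hnn₁ x (by
      rw [hqe]
      exact mul_neg_of_neg_of_pos (mul_neg_of_pos_of_neg (by linarith) (by linarith))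
        (mul_pos_of_neg_of_neg (by linarith) (by linarith)))
    have hez := hnn₁ z (by
      rw [hqe]
      exact mul_neg_of_neg_of_pos (mul_neg_of_pos_of_neg (by linarith) (by linarith))
        (mul_pos (by linarith) (by linarith)))
    simp only [eval_mul, eval_sub, eval_X, eval_C] at hex hez
    have hc1 : 0 ≤ c₁ := nonneg_of_mul_nonneg_right hez (by linarith)
    have hc2 : c₁ ≤ 0 := by
      by_contra! h
      have := mul_neg_of_neg_of_pos (sub_neg.2 hxγ) h
      linarith
    have : c₁ = 0 := le_antisymm hc2 hc1
    simp [this] at hc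

lemma repA_sq_add_nonneg {f : CurveRing q} (hpsd : IsPsd q f) (x : ℝ) :
    0 ≤ (repA q f ^ 2 + q * repB q f ^ 2).eval x := by
  simp only [eval_add, eval_mul, eval_pow]
  rcases le_total 0 (q.eval x) with hx | hx
  · positivity
  · have hv : √(-q.eval x) ^ 2 = -q.eval x := Real.sq_sqrt (by linarith)
    have h1 := hpsd x (√(-q.eval x)) (by linarith)
    have h2 := hpsd x (-√(-q.eval x)) (by rw [neg_sq]; linarith)
    have := mul_nonneg h1 h2
    linear_combination this - (repB q f).eval x ^ 2 * hv

lemma repA_sq_add_roots_real {f : CurveRing q} (hz : AllZerosReal q f) (u : ℂ)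
    (hu : ((repA q f ^ 2 + q * repB q f ^ 2).map (algebraMap ℝ ℂ)).eval u = 0) :
    u.im = 0 := by
  obtain ⟨v, hv⟩ := IsAlgClosed.exists_pow_nat_eq (-(q.map (algebraMap ℝ ℂ)).eval u) two_pos
  simp only [Polynomial.map_add, Polynomial.map_mul, Polynomial.map_pow, eval_add, eval_mul,
    eval_pow] at hu
  have hprod : (((repA q f).map (algebraMap ℝ ℂ)).eval u +
      ((repB q f).map (algebraMap ℝ ℂ)).eval u * v) *
      (((repA q f).map (algebraMap ℝ ℂ)).eval u +
      ((repB q f).map (algebraMap ℝ ℂ)).eval u * -v) = 0 := by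
    linear_combination hu - ((repB q f).map (algebraMap ℝ ℂ)).eval u ^ 2 * hv
  rcases mul_eq_zero.1 hprod with h | h
  · exact (hz u v (by rw [hv]; ring) h).1
  · exact (hz u (-v) (by rw [neg_sq, hv]; ring) h).1

/-- If `a² + q b² = s²`, the squarefree part of `a + s` divides `q`. -/
lemma squarefree_part_dvd (hq0 : q ≠ 0) {f : CurveRing q} (hz : AllZerosReal q f)
    {s e t : ℝ[X]} (hs : repA q f ^ 2 + q * repB q f ^ 2 = s ^ 2)
    (het : repA q f + s = e * t ^ 2) (he : Squarefree e) (ht : t ≠ 0)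
    (hnn : ∀ x, q.eval x < 0 → 0 ≤ e.eval x) : e ∣ q := by
  refine dvd_of_squarefree_of_forall_prime_dvd he hq0 fun π hπ hπe => ?_
  by_contra hπq
  have hfac : e * t ^ 2 * (s - repA q f) = q * repB q f ^ 2 := by
    rw [← het]; linear_combination -hs
  have hm := prime_dvd_of_squarefree_mul_sq_mul_eq hπ he hπe ht hπq hfac
  have hp : π ∣ repA q f + s := het ▸ hπe.mul_right _
  have hb : π ∣ repB q f :=
    hπ.dvd_of_dvd_pow ((hπ.dvd_or_dvd (hfac ▸ hm.mul_left _)).resolve_left hπq)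
  have ha : π ∣ repA q f := by
    have h2 : π ∣ C 2 * repA q f := by
      have := dvd_sub hp hm
      rwa [show repA q f + s - (s - repA q f) = C 2 * repA q f by
        rw [show (C 2 : ℝ[X]) = 2 from rfl]; ring] at this
    have hu : IsUnit (C 2 : ℝ[X]) := isUnit_C.2 (by simp)
    exact hu.dvd_mul_left.1 h2
  obtain ⟨u, hu⟩ := IsAlgClosed.exists_root (π.map (algebraMap ℝ ℂ))
    (by rw [degree_map]; exact (degree_pos_of_ne_zero_of_nonunit hπ.ne_zero hπ.not_isUnit).ne')
  have hroot : ∀ g : ℝ[X], π ∣ g → (g.map (algebraMap ℝ ℂ)).eval u = 0 := by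
    rintro g ⟨k, rfl⟩
    simp [show (π.map (algebraMap ℝ ℂ)).eval u = 0 from hu]
  obtain ⟨v, hv⟩ := IsAlgClosed.exists_pow_nat_eq (-(q.map (algebraMap ℝ ℂ)).eval u) two_pos
  obtain ⟨hui, hvi⟩ := hz u v (by rw [hv]; ring) (by rw [hroot _ ha, hroot _ hb]; ring)
  obtain ⟨r, rfl⟩ : ∃ r : ℝ, (r : ℂ) = u := ⟨u.re, by apply Complex.ext <;> simp [hui]⟩
  obtain ⟨w, rfl⟩ : ∃ w : ℝ, (w : ℂ) = v := ⟨v.re, by apply Complex.ext <;> simp [hvi]⟩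
  have hev : ∀ g : ℝ[X], (g.map (algebraMap ℝ ℂ)).eval (r : ℂ) = (g.eval r : ℝ) := fun g =>
    eval_map_apply (algebraMap ℝ ℂ) r
  rw [hev] at hv
  have hv' : w ^ 2 = -q.eval r := by exact_mod_cast hv
  have hπr : π.eval r = 0 := by have := hroot π dvd_rfl; rw [hev] at this; exact_mod_cast this
  have her : e.eval r = 0 := by have := hroot e hπe; rw [hev] at this; exact_mod_cast this
  have hqr : q.eval r < 0 := by
    refine lt_of_le_of_ne (by nlinarith) fun h0 => hπq ?_
    exact ((prime_X_sub_C r).irreducible.dvd_symm hπ.irreducible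
      (dvd_iff_isRoot.2 hπr)).trans (dvd_iff_isRoot.2 h0)
  exact eval_ne_zero_of_squarefree_of_nonneg he (U := {x | q.eval x < 0})
    (isOpen_lt q.continuous continuous_const) hnn hqr her

end SquareClasses

/-- Proposition 2.7 / `psdrzgp`: every nonzero psd `f ∈ ℝ[C]` with
only real zeros on `C(ℂ)` lies in the square class of one of `1`, `x−α`, `β−x`,
`(x−α)(β−x)` in `ℝ(C)*/ℝ(C)*²`, and these four square classes are pairwise distinct. -/
theorem square_classes_of_psd_with_real_zeros
    (q : Polynomial ℝ) (hmonic : q.Monic) (hdeg : q.natDegree = 4)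
    (hsep : Squarefree (q.map (algebraMap ℝ ℂ)))
    (hindef : ∃ x : ℝ, q.eval x < 0)
    (α β : ℝ) (hα : q.eval α = 0) (hβ : q.eval β = 0)
    (hαβ : ∀ x : ℝ, q.eval x = 0 → α ≤ x ∧ x ≤ β) :
    (∀ f : CurveRing q, f ≠ 0 → IsPsd q f → AllZerosReal q f →
      ∃ (i : Fin 4) (w : FractionRing (CurveRing q)),
        algebraMap (CurveRing q) (FractionRing (CurveRing q)) f =
          algebraMap (CurveRing q) (FractionRing (CurveRing q)) (sqClassReps q α β i) * w ^ 2) ∧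
    (∀ i j : Fin 4, i ≠ j → ∀ w : FractionRing (CurveRing q),
      algebraMap (CurveRing q) (FractionRing (CurveRing q)) (sqClassReps q α β i) ≠
        algebraMap (CurveRing q) (FractionRing (CurveRing q)) (sqClassReps q α β j) * w ^ 2) := by
  have hsq : Squarefree q := by
    have h := PerfectField.separable_iff_squarefree.2 hsep
    exact PerfectField.separable_iff_squarefree.1 ((separable_map _).1 h)
  have hqu : ¬ IsUnit q := fun h => by
    have := natDegree_eq_zero_of_isUnit h
    omega
  have := CurveRing.isDomain hsq hqu
  obtain ⟨x₀, hx₀⟩ := id hindef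
  have hlt : α < β := by
    obtain ⟨r, hr, hr0⟩ := exists_root_gt_of_eval_neg hmonic (by omega) hx₀
    obtain ⟨l, hl, hl0⟩ := exists_root_lt_of_eval_neg hmonic (by omega) (by rw [hdeg]; decide) hx₀
    linarith [(hαβ l hl0).1, (hαβ r hr0).2]
  obtain ⟨p, hp⟩ : ∃ p, q = (X - C α) * (X - C β) * p := by
    obtain ⟨k, hk⟩ := dvd_iff_isRoot.2 hα
    have hkβ : k.eval β = 0 := by
      rw [hk] at hβ
      simpa [sub_ne_zero.2 hlt.ne'] using hβ
    obtain ⟨p, rfl⟩ := dvd_iff_isRoot.2 hkβ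
    exact ⟨p, by rw [hk]; ring⟩
  have hinj := IsFractionRing.injective (CurveRing q) (FractionRing (CurveRing q))
  constructor
  · intro f hf hpsd hz
    have hf' := CurveRing.eq_repA_add_repB_mul_root f
    obtain ⟨s, hs, hs0⟩ : ∃ s, repA q f ^ 2 + q * repB q f ^ 2 = s ^ 2 ∧ repA q f + s ≠ 0 := by
      obtain ⟨s, hs⟩ := exists_sq_of_nonneg_of_roots_real (repA_sq_add_nonneg hpsd)
        (repA_sq_add_roots_real hz)
      by_cases h1 : repA q f + s = 0
      · refine ⟨-s, by rw [hs]; ring, fun h2 => hf ?_⟩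
        have hA2 : C (2 : ℝ) * repA q f = 0 := by
          rw [show (C 2 : ℝ[X]) = 2 from rfl]; linear_combination h1 + h2
        have hA : repA q f = 0 := by simpa using hA2
        have hB2 : q * repB q f ^ 2 = 0 := by
          linear_combination hs - (repA q f - s) * h1
        have hB : repB q f = 0 := by simpa [hmonic.ne_zero] using hB2
        rw [hf', hA, hB]; simp
      · exact ⟨s, hs, h1⟩
    obtain ⟨e, t, het, he⟩ := exists_eq_squarefree_mul_sq hs0
    have ht : t ≠ 0 := by rintro rfl; simp [het] at hs0
    have hh : ∀ x, q.eval x < 0 → 0 ≤ (e * t ^ 2).eval x := by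
      intro x hx
      rw [← het, eval_add]
      have hv : √(-q.eval x) ^ 2 = -q.eval x := Real.sq_sqrt (by linarith)
      have h1 := hpsd x (√(-q.eval x)) (by linarith)
      have h2 := hpsd x (-√(-q.eval x)) (by rw [neg_sq]; linarith)
      have hsx := congrArg (eval x) hs
      simp only [eval_add, eval_mul, eval_pow] at hsx
      have habs := abs_le_of_sq_le_sq' (a := s.eval x) (b := (repA q f).eval x)
        (by nlinarith [sq_nonneg ((repB q f).eval x)]) (by linarith)
      linarith [habs.1]
    have hnn : ∀ x, q.eval x < 0 → 0 ≤ e.eval x := fun x hx =>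
      eval_nonneg_of_mul_sq ht (isOpen_lt q.continuous continuous_const) hh hx
    have hdvd := squarefree_part_dvd hmonic.ne_zero hz hs het he ht hnn
    obtain ⟨i, D, W, hD, hW⟩ := ((hasSqClassRep_of_dvd hmonic hdeg hsq hindef hαβ hp hdvd
      hnn).mul_sq t).mul_C (zero_le_two (α := ℝ))
    rw [← het] at hW
    have hG : (AdjoinRoot.of (curvePoly q) (repA q f + s) +
        AdjoinRoot.of (curvePoly q) (repB q f) * AdjoinRoot.root (curvePoly q)) ^ 2 =
        AdjoinRoot.of (curvePoly q) ((repA q f + s) * C 2) * f := by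
      conv_rhs => rhs; rw [hf']
      have hs' := congrArg (AdjoinRoot.of (curvePoly q)) hs
      rw [show (C 2 : ℝ[X]) = 2 from rfl]
      simp only [map_add, map_mul, map_pow, map_ofNat] at hs' ⊢
      linear_combination AdjoinRoot.of (curvePoly q) (repB q f) ^ 2 *
        CurveRing.root_sq (q := q) - hs'
    generalize AdjoinRoot.of (curvePoly q) (repA q f + s) +
        AdjoinRoot.of (curvePoly q) (repB q f) * AdjoinRoot.root (curvePoly q) = G at hG
    have hH0 : AdjoinRoot.of (curvePoly q) ((repA q f + s) * C 2) ≠ 0 := by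
      rw [map_ne_zero_iff _ CurveRing.of_injective]
      exact mul_ne_zero hs0 (C_ne_zero.2 two_ne_zero)
    rw [map_mul _ (_ * _) (D ^ 2), map_pow] at hW
    generalize AdjoinRoot.of (curvePoly q) ((repA q f + s) * C 2) = H at hG hW hH0
    have hD0 : AdjoinRoot.of (curvePoly q) D ≠ 0 :=
      (map_ne_zero_iff _ CurveRing.of_injective).2 hD
    generalize AdjoinRoot.of (curvePoly q) D = D' at hW hD0
    have hG' := congrArg (algebraMap (CurveRing q) (FractionRing (CurveRing q))) hG
    have hW' := congrArg (algebraMap (CurveRing q) (FractionRing (CurveRing q))) hW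
    have hH' := (map_ne_zero_iff _ hinj).2 hH0
    have hD' := (map_ne_zero_iff _ hinj).2 hD0
    simp only [map_mul, map_pow] at hG' hW'
    refine ⟨i, algebraMap _ _ W * algebraMap _ _ G / (algebraMap _ _ D' * algebraMap _ _ H), ?_⟩
    field_simp
    rw [← hW', hG']
    ring
  · have key : ∀ k m : ℝ[X], q = k * m → ¬ IsUnit k → ¬ IsUnit m →
        ∀ w : FractionRing (CurveRing q),
          algebraMap (CurveRing q) (FractionRing (CurveRing q)) (AdjoinRoot.of (curvePoly q) k) ≠
            w ^ 2 := by
      intro k m hkm hk hm w hw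
      obtain ⟨n, d, hd, rfl⟩ := IsFractionRing.div_surjective (A := CurveRing q) w
      have hd0 := nonZeroDivisors.ne_zero hd
      have hd' := (map_ne_zero_iff _ hinj).2 hd0
      refine CurveRing.mul_sq_ne_sq hsq hkm hk hm (n := n) hd0 (hinj ?_)
      rw [map_mul, map_pow, map_pow, hw]
      field_simp
    have hpu : ¬ IsUnit p := fun h => by
      have h0 := natDegree_eq_zero_of_isUnit h
      have hp0 := h.ne_zero
      rw [hp, natDegree_mul (mul_ne_zero (X_sub_C_ne_zero _) (X_sub_C_ne_zero _)) hp0,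
        natDegree_mul (X_sub_C_ne_zero _) (X_sub_C_ne_zero _), natDegree_X_sub_C,
        natDegree_X_sub_C] at hdeg
      omega
    have hαu := not_isUnit_X_sub_C α
    have hβu : ¬ IsUnit (C β - X) := by
      rw [← neg_sub, IsUnit.neg_iff]; exact not_isUnit_X_sub_C β
    have kα := key (X - C α) ((X - C β) * p) (by rw [hp]; ring) hαu
      (fun h => hpu (isUnit_of_mul_isUnit_right h))
    have kβ := key (C β - X) (-((X - C α) * p)) (by rw [hp]; ring) hβu
      (fun h => hpu (isUnit_of_mul_isUnit_right ((IsUnit.neg_iff _).1 h)))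
    have kαβ := key ((X - C α) * (C β - X)) (-p) (by rw [hp]; ring)
      (fun h => hαu (isUnit_of_mul_isUnit_left h)) (fun h => hpu ((IsUnit.neg_iff _).1 h))
    intro i j hij w hw
    have hreps : ∀ i, algebraMap (CurveRing q) (FractionRing (CurveRing q)) (sqClassReps q α β i) =
        ![1, algebraMap (CurveRing q) _ (AdjoinRoot.of (curvePoly q) (X - C α)),
          algebraMap (CurveRing q) _ (AdjoinRoot.of (curvePoly q) (C β - X)),
          algebraMap (CurveRing q) _ (AdjoinRoot.of (curvePoly q) (X - C α)) *
            algebraMap (CurveRing q) _ (AdjoinRoot.of (curvePoly q) (C β - X))] i := by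
      intro i
      fin_cases i <;> simp [sqClassReps]
    rw [hreps, hreps] at hw
    exact klein_four_reps_ne_mul_sq kα kβ
      (fun w => by rw [← map_mul, ← map_mul]; exact kαβ w) hij w hw

end
end

section
/- Let f, g be nonzero psd elements of ℝ[C]. Assume that every zero of g on C(ℂ) is real and that f/g is a square in ℝ(C). If g = b₁² + ⋯ + b_r² with nonzero b₁, …, b_r ∈ ℝ[C], then there exist a₁, …, a_r ∈ ℝ[C] with f = a₁² + ⋯ + a_r² and δ(a_i) = δ(b_i) + (δ(f) − δ(g))/2 for each i = 1, …, r. In particular, 2θ(f) − δ(f) ≤ 2θ(g) − δ(g). -/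
open Polynomial

noncomputable section

/-- In a Dedekind domain, at a prime with formally real residue field, the valuation of a sum of
squares is the largest valuation of its terms. -/
lemma valuation_sq_le_valuation_sum_sq {R K : Type*} [CommRing R] [IsDedekindDomain R] [Field K]
    [Algebra R K] [IsFractionRing R K] (v : IsDedekindDomain.HeightOneSpectrum R)
    {ι : Type*} [Fintype ι]
    (hreal : ∀ c : ι → R, ∑ i, c i ^ 2 ∈ v.asIdeal → ∀ i, c i ∈ v.asIdeal)
    (b : ι → K) (i : ι) : v.valuation K (b i) ^ 2 ≤ v.valuation K (∑ j, b j ^ 2) := by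
  obtain ⟨j, -, hj⟩ := Finset.exists_max_image Finset.univ (fun i => v.valuation K (b i))
    ⟨i, Finset.mem_univ i⟩
  refine (pow_le_pow_left₀ zero_le (hj i (Finset.mem_univ i)) 2).trans ?_
  by_cases hbj : b j = 0
  · simp [hbj]
  have hvj : v.valuation K (b j) ≠ 0 := (Valuation.ne_zero_iff _).2 hbj
  have hx : ∀ k, v.valuation K (b k / b j) ≤ 1 := fun k => by
    rw [map_div₀]
    exact div_le_one_of_le₀ (hj k (Finset.mem_univ k)) zero_le
  choose n hn using fun k => v.exists_valuation_sub_lt_of_integer (hx k) 1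
  simp only [Units.val_one] at hn
  have hnj : n j ∉ v.asIdeal := by
    rw [← v.valuation_lt_one_iff_mem (K := K)]
    intro h
    have h1 := Valuation.map_sub_lt _ h (hn j)
    rw [sub_sub_cancel, div_self hbj, map_one] at h1
    exact lt_irrefl _ h1
  have hsum : v.valuation K (algebraMap R K (∑ k, n k ^ 2)) = 1 :=
    v.valuation_eq_one_iff_notMem.2 fun h => hnj (hreal n h j)
  have hdiff : v.valuation K (∑ k, (algebraMap R K (n k) ^ 2 - (b k / b j) ^ 2)) < 1 := by
    refine Valuation.map_sum_lt _ one_ne_zero fun k _ => ?_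
    rw [sq_sub_sq, map_mul]
    exact (mul_le_of_le_one_left zero_le
      (Valuation.map_add_le _ (v.valuation_le_one _) (hx k))).trans_lt (hn k)
  have hge : 1 ≤ v.valuation K (∑ k, (b k / b j) ^ 2) := by
    by_contra! h
    have h1 := Valuation.map_add_lt _ hdiff h
    rw [Finset.sum_sub_distrib, sub_add_cancel] at h1
    simp only [← map_pow, ← map_sum] at h1
    rw [hsum] at h1
    exact lt_irrefl _ h1
  have heq : ∑ k, b k ^ 2 = b j ^ 2 * ∑ k, (b k / b j) ^ 2 := by
    rw [Finset.mul_sum]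
    exact Finset.sum_congr rfl fun k _ => by field_simp
  rw [heq, map_mul, map_pow]
  exact le_mul_of_one_le_right zero_le hge

/-- If `f = (∑ bᵢ²) w²` lies in a Dedekind domain and every prime either has formally real residue
field or does not contain `∑ bᵢ²`, then the `w bᵢ` are integral. -/
lemma exists_algebraMap_eq_mul_of_sum_sq {R K : Type*} [CommRing R] [IsDedekindDomain R] [Field K]
    [Algebra R K] [IsFractionRing R K] {ι : Type*} [Fintype ι] (f : R) (b : ι → R) (w : K)
    (hfw : algebraMap R K f = algebraMap R K (∑ i, b i ^ 2) * w ^ 2)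
    (hprime : ∀ M : Ideal R, M.IsMaximal → ∑ i, b i ^ 2 ∉ M ∨
      ∀ c : ι → R, ∑ i, c i ^ 2 ∈ M → ∀ i, c i ∈ M) (i : ι) :
    ∃ a : R, algebraMap R K a = w * algebraMap R K (b i) := by
  refine IsDedekindDomain.HeightOneSpectrum.mem_integers_of_valuation_le_one K _ fun v => ?_
  have hf : v.valuation K (algebraMap R K f) ≤ 1 := v.valuation_le_one f
  rw [hfw, map_mul, map_pow] at hf
  rw [map_mul]
  rcases hprime v.asIdeal v.isMaximal with h | h
  · rw [v.valuation_eq_one_iff_notMem.2 h, one_mul] at hf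
    exact mul_le_one' ((pow_le_one_iff two_ne_zero).1 hf) (v.valuation_le_one _)
  · rw [← pow_le_one_iff two_ne_zero, mul_pow, mul_comm]
    refine (mul_le_mul_left ?_ _).trans hf
    simpa using valuation_sq_le_valuation_sum_sq v h (fun i => algebraMap R K (b i)) i

lemma Squarefree.dvd_of_sq_dvd_sq_mul {q b c : ℝ[X]} (hq : Squarefree q)
    (h : c ^ 2 ∣ b ^ 2 * q) : c ∣ b := by
  by_cases hc : c = 0
  · subst hc
    have : b ^ 2 * q = 0 := by simpa using h
    simpa [hq.ne_zero] using this
  obtain ⟨b', c', d, hd, rfl, rfl⟩ :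
      ∃ b' c' d : ℝ[X], IsCoprime c' b' ∧ b = d * b' ∧ c = d * c' := by
    obtain ⟨c', hc'⟩ := EuclideanDomain.gcd_dvd_left c b
    obtain ⟨b', hb'⟩ := EuclideanDomain.gcd_dvd_right c b
    have hne : EuclideanDomain.gcd c b ≠ 0 := fun h0 => hc (by rw [hc', h0, zero_mul])
    refine ⟨b', c', EuclideanDomain.gcd c b, ?_, hb', hc'⟩
    obtain ⟨s, t, hst⟩ : ∃ s t, EuclideanDomain.gcd c b = c * s + b * t :=
      ⟨_, _, EuclideanDomain.gcd_eq_gcd_ab c b⟩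
    refine ⟨s, t, mul_left_cancel₀ hne ?_⟩
    calc _ = (EuclideanDomain.gcd c b * c') * s + (EuclideanDomain.gcd c b * b') * t := by ring
      _ = _ := by rw [← hc', ← hb', ← hst, mul_one]
  have hd0 : d ≠ 0 := left_ne_zero_of_mul hc
  rw [mul_pow, mul_pow, mul_assoc, mul_dvd_mul_iff_left (pow_ne_zero 2 hd0)] at h
  have h1 : c' ^ 2 ∣ q := (hd.pow (m := 2) (n := 2)).dvd_of_dvd_mul_left h
  have h2 : IsUnit c' := hq c' (by rwa [← sq])
  exact mul_dvd_mul_left d h2.dvd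

section CurveRing

variable {q : ℝ[X]}

lemma curveRing_root_sq :
    AdjoinRoot.root (curvePoly q) ^ 2 = -AdjoinRoot.of (curvePoly q) q := by
  have h : AdjoinRoot.mk (curvePoly q) (X ^ 2 + C q) = 0 := AdjoinRoot.mk_self
  rw [map_add, map_pow, AdjoinRoot.mk_X, AdjoinRoot.mk_C] at h
  exact eq_neg_of_add_eq_zero_left h

/-- The element `a(x) + b(x)·y` of the coordinate ring. -/
def curveElem (q a b : ℝ[X]) : CurveRing q :=
  AdjoinRoot.of (curvePoly q) a + AdjoinRoot.of (curvePoly q) b * AdjoinRoot.root (curvePoly q)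

lemma curvePoly_natDegree : (curvePoly q).natDegree = 2 := natDegree_X_pow_add_C

lemma curveRep_curveElem (a b : ℝ[X]) : curveRep q (curveElem q a b) = C a + C b * X := by
  have h : curveElem q a b = AdjoinRoot.mk (curvePoly q) (C a + C b * X) := by
    simp [curveElem]
  rw [curveRep, h, AdjoinRoot.modByMonicHom_mk, modByMonic_eq_self_iff (curvePoly_monic q)]
  refine degree_lt_degree ?_
  rw [curvePoly_natDegree, add_comm]
  exact (natDegree_linear_le).trans_lt one_lt_two

@[simp] lemma repA_curveElem (a b : ℝ[X]) : repA q (curveElem q a b) = a := by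
  simp [repA, curveRep_curveElem]

@[simp] lemma repB_curveElem (a b : ℝ[X]) : repB q (curveElem q a b) = b := by
  simp [repB, curveRep_curveElem]

lemma curveElem_rep (f : CurveRing q) : curveElem q (repA q f) (repB q f) = f := by
  have h := AdjoinRoot.mk_leftInverse (curvePoly_monic q) f
  have hlt : (curveRep q f).natDegree < 2 := by
    obtain ⟨p, rfl⟩ := AdjoinRoot.mk_surjective f
    rw [curveRep, AdjoinRoot.modByMonicHom_mk, ← curvePoly_natDegree (q := q)]
    refine natDegree_modByMonic_lt _ (curvePoly_monic q) fun h1 => ?_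
    have := curvePoly_natDegree (q := q)
    simp [h1] at this
  change AdjoinRoot.mk (curvePoly q) (curveRep q f) = f at h
  conv_rhs => rw [← h, (curveRep q f).as_sum_range_C_mul_X_pow' hlt]
  simp [Finset.sum_range_succ, curveElem, repA, repB]

lemma exists_eq_curveElem (f : CurveRing q) : ∃ a b, f = curveElem q a b :=
  ⟨_, _, (curveElem_rep f).symm⟩

lemma curveElem_mul (a b c d : ℝ[X]) :
    curveElem q a b * curveElem q c d = curveElem q (a * c - q * b * d) (a * d + b * c) := by
  simp only [curveElem, map_sub, map_add, map_mul]
  linear_combination (AdjoinRoot.of (curvePoly q) b * AdjoinRoot.of (curvePoly q) d) *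
    curveRing_root_sq (q := q)

lemma curveElem_zero : curveElem q 0 0 = 0 := by simp [curveElem]

/-- The norm `a² + q b²` of `a + b y`. -/
def curveNorm (q : ℝ[X]) (f : CurveRing q) : ℝ[X] := repA q f ^ 2 + repB q f ^ 2 * q

lemma curveNorm_mul (f g : CurveRing q) : curveNorm q (f * g) = curveNorm q f * curveNorm q g := by
  obtain ⟨a, b, rfl⟩ := exists_eq_curveElem f
  obtain ⟨c, d, rfl⟩ := exists_eq_curveElem g
  simp only [curveNorm, curveElem_mul, repA_curveElem, repB_curveElem]
  ring

lemma degree_curveNorm (hmonic : q.Monic) (f : CurveRing q) (hf : f ≠ 0) :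
    (curveNorm q f).degree = max (repA q f ^ 2).degree (repB q f ^ 2 * q).degree := by
  refine degree_add_eq_of_leadingCoeff_add_ne_zero fun h => hf ?_
  rw [leadingCoeff_mul, hmonic.leadingCoeff, leadingCoeff_pow, leadingCoeff_pow, mul_one] at h
  have ha : repA q f = 0 := leadingCoeff_eq_zero.1 (by nlinarith)
  have hb : repB q f = 0 := leadingCoeff_eq_zero.1 (by nlinarith)
  rw [← curveElem_rep f, ha, hb, curveElem_zero]

lemma curveNorm_ne_zero (hmonic : q.Monic) {f : CurveRing q} (hf : f ≠ 0) : curveNorm q f ≠ 0 := by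
  intro h
  have h1 := degree_curveNorm hmonic f hf
  rw [h, degree_zero, eq_comm, max_eq_bot, degree_eq_bot, degree_eq_bot] at h1
  refine hf ?_
  rw [← curveElem_rep f, eq_zero_of_pow_eq_zero h1.1,
    eq_zero_of_pow_eq_zero ((mul_eq_zero.1 h1.2).resolve_right hmonic.ne_zero), curveElem_zero]

lemma natDegree_curveNorm (hmonic : q.Monic) (hdeg : q.natDegree = 4) {f : CurveRing q}
    (hf : f ≠ 0) : (curveNorm q f).natDegree = 2 * curveDelta q f := by
  have h := degree_curveNorm hmonic f hf
  have hn : (curveNorm q f).natDegree =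
      max (repA q f ^ 2).natDegree (repB q f ^ 2 * q).natDegree := by
    by_cases ha : repA q f = 0
    · simp [curveNorm, ha]
    by_cases hb : repB q f = 0
    · simp [curveNorm, hb]
    rw [degree_eq_natDegree (curveNorm_ne_zero hmonic hf), degree_eq_natDegree (pow_ne_zero 2 ha),
      degree_eq_natDegree (mul_ne_zero (pow_ne_zero 2 hb) hmonic.ne_zero)] at h
    rw [← (Nat.mono_cast (α := WithBot ℕ)).map_max] at h
    exact_mod_cast h
  rw [hn, curveDelta]
  split_ifs with hb
  · simp [hb]
  · rw [natDegree_mul (pow_ne_zero 2 hb) hmonic.ne_zero, natDegree_pow, natDegree_pow, hdeg]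
    omega

lemma curveDelta_mul (hmonic : q.Monic) (hdeg : q.natDegree = 4) {f g : CurveRing q}
    (hf : f ≠ 0) (hg : g ≠ 0) :
    f * g ≠ 0 ∧ curveDelta q (f * g) = curveDelta q f + curveDelta q g := by
  have hNf := curveNorm_ne_zero hmonic hf
  have hNg := curveNorm_ne_zero hmonic hg
  have hfg : f * g ≠ 0 := by
    intro h
    refine mul_ne_zero hNf hNg ?_
    rw [← curveNorm_mul, h, ← curveElem_zero]
    simp [curveNorm]
  refine ⟨hfg, ?_⟩
  have h := natDegree_curveNorm hmonic hdeg hfg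
  rw [curveNorm_mul, natDegree_mul hNf hNg, natDegree_curveNorm hmonic hdeg hf,
    natDegree_curveNorm hmonic hdeg hg] at h
  omega

lemma curveRing_isDomain (hmonic : q.Monic) : IsDomain (CurveRing q) := by
  have : Nontrivial (CurveRing q) := by
    refine ⟨curveElem q 1 0, curveElem q 0 0, fun h => one_ne_zero (α := ℝ[X]) ?_⟩
    simpa using congrArg (repA q) h
  have : NoZeroDivisors (CurveRing q) := ⟨fun {f g} h => by
    have h1 : curveNorm q f * curveNorm q g = 0 := by
      rw [← curveNorm_mul, h, ← curveElem_zero]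
      simp [curveNorm]
    rcases mul_eq_zero.1 h1 with h2 | h2
    · exact Or.inl (by_contra fun h3 => curveNorm_ne_zero hmonic h3 h2)
    · exact Or.inr (by_contra fun h3 => curveNorm_ne_zero hmonic h3 h2)⟩
  exact NoZeroDivisors.to_isDomain _

/-- The conjugation `y ↦ -y`. -/
def curveConj (q : ℝ[X]) : CurveRing q →ₐ[ℝ[X]] CurveRing q :=
  AdjoinRoot.liftAlgHom (curvePoly q) (Algebra.ofId _ _) (-AdjoinRoot.root (curvePoly q)) (by
    change eval₂ _ _ (X ^ 2 + C q) = 0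
    rw [eval₂_add, eval₂_pow, eval₂_X, eval₂_C, neg_sq]
    exact (congrArg (· + _) curveRing_root_sq).trans (neg_add_cancel _))

lemma curveConj_curveElem (a b : ℝ[X]) : curveConj q (curveElem q a b) = curveElem q a (-b) := by
  simp [curveConj, curveElem, Algebra.ofId_apply, AdjoinRoot.algebraMap_eq]

/-- Divisibility from integrality of a quotient in an extension field. -/
lemma dvd_of_isIntegral_div {A K : Type*} [CommRing A] [IsDomain A] [IsIntegrallyClosed A]
    [Field K] [Algebra A K] (hinj : Function.Injective (algebraMap A K)) {a c : A} (hc : c ≠ 0)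
    (h : IsIntegral A (algebraMap A K a / algebraMap A K c)) : c ∣ a := by
  let j : FractionRing A →ₐ[A] K := IsFractionRing.liftAlgHom (g := Algebra.ofId A K) hinj
  have hc' : algebraMap A (FractionRing A) c ≠ 0 := by simpa using hc
  have hj : j (algebraMap A (FractionRing A) a / algebraMap A (FractionRing A) c) =
      algebraMap A K a / algebraMap A K c := by
    rw [map_div₀, j.commutes, j.commutes]
  rw [← hj, isIntegral_algHom_iff j j.toRingHom.injective] at h
  obtain ⟨d, hd⟩ := IsIntegrallyClosed.isIntegral_iff.1 h
  refine ⟨d, IsFractionRing.injective A (FractionRing A) ?_⟩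
  rw [map_mul, hd, mul_div_cancel₀ _ hc']

lemma algebraMap_curveRing_injective :
    Function.Injective (algebraMap ℝ[X] (CurveRing q)) := by
  intro a b h
  have h1 := congrArg (repA q) (show curveElem q a 0 = curveElem q b 0 by
    simpa [curveElem, AdjoinRoot.algebraMap_eq] using h)
  simpa using h1

lemma exists_algebraMap_curveRing_eq_of_isIntegral (hmonic : q.Monic) (hsq : Squarefree q)
    {K : Type*} [Field K] [Algebra (CurveRing q) K] [IsFractionRing (CurveRing q) K]
    [Algebra ℝ[X] K] [IsScalarTower ℝ[X] (CurveRing q) K] (z : K) (hz : IsIntegral ℝ[X] z) :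
    ∃ r, algebraMap (CurveRing q) K r = z := by
  have hdom := curveRing_isDomain hmonic
  have hinjR := algebraMap_curveRing_injective (q := q)
  have hinjK : Function.Injective (algebraMap ℝ[X] K) := by
    rw [IsScalarTower.algebraMap_eq ℝ[X] (CurveRing q) K]
    exact (IsFractionRing.injective (CurveRing q) K).comp hinjR
  obtain ⟨n, d, hd, rfl⟩ := IsFractionRing.div_surjective (A := CurveRing q) z
  have hd : d ≠ 0 := nonZeroDivisors.ne_zero hd
  obtain ⟨a, b, c, hc, hz'⟩ : ∃ a b c : ℝ[X], c ≠ 0 ∧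
      algebraMap (CurveRing q) K n / algebraMap (CurveRing q) K d =
        algebraMap (CurveRing q) K (curveElem q a b) / algebraMap ℝ[X] K c := by
    have h1 : d * curveConj q d = algebraMap ℝ[X] (CurveRing q) (curveNorm q d) := by
      obtain ⟨s, t, rfl⟩ := exists_eq_curveElem d
      rw [curveConj_curveElem, curveElem_mul, curveNorm, repA_curveElem, repB_curveElem]
      simp only [curveElem, AdjoinRoot.algebraMap_eq]
      rw [show s * -t + t * s = 0 by ring, map_zero, zero_mul, add_zero]
      congr 1
      ring
    have hN := curveNorm_ne_zero hmonic hd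
    obtain ⟨a, b, hab⟩ := exists_eq_curveElem (n * curveConj q d)
    refine ⟨a, b, curveNorm q d, hN, ?_⟩
    rw [← hab, IsScalarTower.algebraMap_apply ℝ[X] (CurveRing q) K, ← h1, map_mul, map_mul,
      mul_div_mul_right]
    rw [Ne, FaithfulSMul.algebraMap_eq_zero_iff]
    intro h2
    rw [h2, mul_zero, eq_comm, map_eq_zero_iff _ hinjR] at h1
    exact hN h1
  rw [hz'] at hz ⊢
  have hcK : algebraMap ℝ[X] K c ≠ 0 := by rwa [Ne, map_eq_zero_iff _ hinjK]
  have hσinj : Function.Injective (curveConj q) := by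
    rw [injective_iff_map_eq_zero]
    intro r hr
    obtain ⟨s, t, rfl⟩ := exists_eq_curveElem r
    rw [curveConj_curveElem] at hr
    have hs := congrArg (repA q) hr
    have ht := congrArg (repB q) hr
    rw [← curveElem_zero] at hs ht
    simp only [repA_curveElem, repB_curveElem, neg_eq_zero] at hs ht
    rw [hs, ht, curveElem_zero]
  have hginj : Function.Injective
      ((IsScalarTower.toAlgHom ℝ[X] (CurveRing q) K).comp (curveConj q)) :=
    (IsFractionRing.injective (CurveRing q) K).comp hσinj
  let τ : K →ₐ[ℝ[X]] K := IsFractionRing.liftAlgHom hginj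
  have hτ : τ (algebraMap (CurveRing q) K (curveElem q a b) / algebraMap ℝ[X] K c) =
      algebraMap (CurveRing q) K (curveElem q a (-b)) / algebraMap ℝ[X] K c := by
    rw [map_div₀, τ.commutes, ← curveConj_curveElem]
    congr 1
    exact IsFractionRing.lift_algebraMap hginj _
  have hz2 := hz.map τ
  rw [hτ] at hz2
  have hsum : c ∣ 2 * a := by
    have he : curveElem q a b + curveElem q a (-b) = algebraMap ℝ[X] (CurveRing q) (2 * a) := by
      simp only [curveElem, AdjoinRoot.algebraMap_eq, map_neg, map_mul, map_ofNat]
      ring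
    have h := hz.add hz2
    rw [← add_div, ← map_add, he, ← IsScalarTower.algebraMap_apply] at h
    exact dvd_of_isIntegral_div hinjK hc h
  have hprod : c ^ 2 ∣ a ^ 2 + b ^ 2 * q := by
    have he : curveElem q a b * curveElem q a (-b) =
        algebraMap ℝ[X] (CurveRing q) (a ^ 2 + b ^ 2 * q) := by
      rw [curveElem_mul, show a * -b + b * a = 0 by ring]
      simp only [curveElem, AdjoinRoot.algebraMap_eq, map_zero, zero_mul, add_zero]
      congr 1
      ring
    have h := hz.mul hz2
    rw [div_mul_div_comm, ← map_mul, he, ← IsScalarTower.algebraMap_apply, ← sq, ← map_pow] at h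
    exact dvd_of_isIntegral_div hinjK (pow_ne_zero 2 hc) h
  have h2 : IsUnit (2 : ℝ[X]) := by
    rw [show (2 : ℝ[X]) = C 2 from rfl]
    exact (isUnit_iff_ne_zero.2 two_ne_zero).map C
  have hca : c ∣ a := (h2.dvd_mul_left).1 hsum
  have hcb : c ∣ b := hsq.dvd_of_sq_dvd_sq_mul
    ((dvd_add_right (pow_dvd_pow_of_dvd hca 2)).1 hprod)
  obtain ⟨a', rfl⟩ := hca
  obtain ⟨b', rfl⟩ := hcb
  refine ⟨curveElem q a' b', ?_⟩
  rw [eq_div_iff hcK, IsScalarTower.algebraMap_apply ℝ[X] (CurveRing q) K, ← map_mul]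
  congr 1
  simp only [curveElem, AdjoinRoot.algebraMap_eq, map_mul]
  ring

lemma curveRing_isDedekindDomain (hmonic : q.Monic) (hsq : Squarefree q) :
    IsDedekindDomain (CurveRing q) := by
  have hdom := curveRing_isDomain hmonic
  have hfin : Module.Finite ℝ[X] (CurveRing q) := (curvePoly_monic q).finite_adjoinRoot
  have hint : Algebra.IsIntegral ℝ[X] (CurveRing q) := inferInstance
  have hdim : Ring.DimensionLEOne (CurveRing q) := Ring.DimensionLEOne.of_isIntegral ℝ[X] _
  have hcl : IsIntegrallyClosed (CurveRing q) := by
    rw [isIntegrallyClosed_iff (FractionRing (CurveRing q))]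
    intro z hz
    exact exists_algebraMap_curveRing_eq_of_isIntegral hmonic hsq z (isIntegral_trans z hz)
  exact { }

lemma exists_ker_eq_of_isMaximal (M : Ideal (CurveRing q)) (hM : M.IsMaximal) :
    ∃ φ : CurveRing q →ₐ[ℝ] ℂ, ∀ r, φ r = 0 ↔ r ∈ M := by
  let := Ideal.Quotient.field M
  have : Algebra.FiniteType ℝ (CurveRing q ⧸ M) :=
    Algebra.FiniteType.of_surjective (Ideal.Quotient.mkₐ ℝ M) Ideal.Quotient.mk_surjective
  have : Module.Finite ℝ (CurveRing q ⧸ M) := finite_of_finite_type_of_isJacobsonRing _ _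
  have : Module.IsTorsionFree ℝ (CurveRing q ⧸ M) := inferInstance
  have : Algebra.IsAlgebraic ℝ (CurveRing q ⧸ M) := Algebra.IsAlgebraic.of_finite _ _
  let ψ : (CurveRing q ⧸ M) →ₐ[ℝ] ℂ := IsAlgClosed.lift
  refine ⟨ψ.comp (Ideal.Quotient.mkₐ ℝ M), fun r => ?_⟩
  rw [AlgHom.comp_apply, map_eq_zero_iff ψ ψ.toRingHom.injective]
  exact Ideal.Quotient.eq_zero_iff_mem

lemma algHom_curveElem (φ : CurveRing q →ₐ[ℝ] ℂ) (a b : ℝ[X]) :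
    φ (curveElem q a b) =
      (a.map (algebraMap ℝ ℂ)).eval (φ (AdjoinRoot.of (curvePoly q) X)) +
      (b.map (algebraMap ℝ ℂ)).eval (φ (AdjoinRoot.of (curvePoly q) X)) *
        φ (AdjoinRoot.root (curvePoly q)) := by
  have h : ∀ p : ℝ[X], φ (AdjoinRoot.of (curvePoly q) p) =
      (p.map (algebraMap ℝ ℂ)).eval (φ (AdjoinRoot.of (curvePoly q) X)) := by
    intro p
    rw [eval_map_algebraMap]
    have h1 : φ.comp (IsScalarTower.toAlgHom ℝ ℝ[X] (CurveRing q)) =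
        aeval (φ (AdjoinRoot.of (curvePoly q) X)) := by
      ext
      simp [AdjoinRoot.algebraMap_eq]
    exact DFunLike.congr_fun h1 p
  rw [curveElem, map_add, map_mul, h a, h b]

lemma notMem_or_sum_sq_mem {g : CurveRing q} (hgz : AllZerosReal q g) (M : Ideal (CurveRing q))
    (hM : M.IsMaximal) {ι : Type*} [Fintype ι] :
    g ∉ M ∨ ∀ c : ι → CurveRing q, ∑ i, c i ^ 2 ∈ M → ∀ i, c i ∈ M := by
  obtain ⟨φ, hφ⟩ := exists_ker_eq_of_isMaximal M hM
  by_cases hg : g ∈ M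
  swap
  · exact Or.inl hg
  right
  obtain ⟨hu, hv⟩ := hgz (φ (AdjoinRoot.of (curvePoly q) X)) (φ (AdjoinRoot.root (curvePoly q)))
    (by
      have h := algHom_curveElem φ q 0
      simp only [curveElem, map_zero, zero_mul, add_zero, Polynomial.map_zero, eval_zero] at h
      rw [← h, ← map_pow, curveRing_root_sq, map_neg, neg_add_cancel])
    (by rw [← algHom_curveElem, curveElem_rep, hφ]; exact hg)
  have hreal : ∀ r, ∃ x : ℝ, φ r = x := by
    intro r
    obtain ⟨a, b, rfl⟩ := exists_eq_curveElem r
    obtain ⟨u, hu⟩ := Complex.conj_eq_iff_real.1 (Complex.conj_eq_iff_im.2 hu)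
    obtain ⟨v, hv⟩ := Complex.conj_eq_iff_real.1 (Complex.conj_eq_iff_im.2 hv)
    refine ⟨a.eval u + b.eval u * v, ?_⟩
    rw [algHom_curveElem, hu, hv, ← Complex.coe_algebraMap, eval_map_apply, eval_map_apply]
    simp
  choose ρ hρ using hreal
  intro c hc i
  have hc' : ∑ i, ρ (c i) ^ 2 = 0 := by
    rw [← hφ, map_sum, Finset.sum_congr rfl fun i _ => by rw [map_pow φ, hρ]] at hc
    exact_mod_cast hc
  rw [Finset.sum_eq_zero_iff_of_nonneg fun i _ => sq_nonneg _] at hc'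
  rw [← hφ, hρ, pow_eq_zero_iff two_ne_zero |>.1 (hc' i (Finset.mem_univ i)), Complex.ofReal_zero]

/-- Transfer of a sum of squares representation along multiplication by a square, allowing
vanishing terms. -/
lemma exists_sum_sq_transfer (hmonic : q.Monic) (hdeg : q.natDegree = 4) (hsq : Squarefree q)
    {f g : CurveRing q} (hf0 : f ≠ 0) (hg0 : g ≠ 0) (hgz : AllZerosReal q g)
    {K : Type*} [Field K] [Algebra (CurveRing q) K] [IsFractionRing (CurveRing q) K]
    (hw : ∃ w : K, algebraMap (CurveRing q) K f = algebraMap (CurveRing q) K g * w ^ 2)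
    {ι : Type*} [Fintype ι] (b : ι → CurveRing q) (hgsos : g = ∑ i, b i ^ 2) :
    ∃ a : ι → CurveRing q, f = ∑ i, a i ^ 2 ∧
      ∀ i, (b i = 0 → a i = 0) ∧ (b i ≠ 0 →
        2 * curveDelta q (a i) + curveDelta q g = 2 * curveDelta q (b i) + curveDelta q f) := by
  have := curveRing_isDedekindDomain hmonic hsq
  obtain ⟨w, hw⟩ := hw
  have hinj := IsFractionRing.injective (CurveRing q) K
  choose a ha using exists_algebraMap_eq_mul_of_sum_sq f b w (hgsos ▸ hw)
    (fun M hM => hgsos ▸ notMem_or_sum_sq_mem hgz M hM)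
  refine ⟨a, hinj ?_, fun i => ⟨fun h => hinj ?_, fun hb => ?_⟩⟩
  · rw [hw, hgsos]
    simp only [map_sum, map_pow, ha, mul_pow, Finset.sum_mul]
    exact Finset.sum_congr rfl fun i _ => mul_comm _ _
  · rw [ha, h, map_zero, mul_zero]
  · obtain ⟨c, d, hd, rfl⟩ := IsFractionRing.div_surjective (A := CurveRing q) w
    have hd : d ≠ 0 := nonZeroDivisors.ne_zero hd
    have hdK : algebraMap (CurveRing q) K d ≠ 0 := by
      rwa [Ne, FaithfulSMul.algebraMap_eq_zero_iff]
    have h1 : f * (d * d) = g * (c * c) := hinj (by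
      simp only [map_mul]
      rw [hw]
      field_simp)
    have h2 : a i * d = c * b i := hinj (by
      simp only [map_mul]
      rw [ha]
      field_simp)
    have hc : c ≠ 0 := by
      rintro rfl
      simp [hf0, hd] at h1
    have hai : a i ≠ 0 := left_ne_zero_of_mul (h2 ▸ mul_ne_zero hc hb)
    have h1' := congrArg (curveDelta q) h1
    have h2' := congrArg (curveDelta q) h2
    simp only [(curveDelta_mul hmonic hdeg hf0 (mul_ne_zero hd hd)).2,
      (curveDelta_mul hmonic hdeg hg0 (mul_ne_zero hc hc)).2,
      (curveDelta_mul hmonic hdeg hd hd).2, (curveDelta_mul hmonic hdeg hc hc).2] at h1'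
    simp only [(curveDelta_mul hmonic hdeg hai hd).2, (curveDelta_mul hmonic hdeg hc hb).2] at h2'
    omega

end CurveRing

/-- Lemma 2.9 / `lemred2gens`: if `g` is psd with only real zeros,
`f` is psd, `f/g` is a square in `ℝ(C)`, and `g = b₁² + ⋯ + b_r²`, then
`f = a₁² + ⋯ + a_r²` with `δ(a_i) = δ(b_i) + (δ(f) − δ(g))/2`; in particular
`2θ(f) − δ(f) ≤ 2θ(g) − δ(g)`. -/
theorem sos_transfer_along_square_class
    (q : Polynomial ℝ) (hmonic : q.Monic) (hdeg : q.natDegree = 4)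
    (hsep : Squarefree (q.map (algebraMap ℝ ℂ)))
    (hindef : ∃ x : ℝ, q.eval x < 0)
    (f g : CurveRing q) (hf0 : f ≠ 0) (hg0 : g ≠ 0)
    (hf : IsPsd q f) (hg : IsPsd q g) (hgz : AllZerosReal q g)
    (hsq : ∃ w : FractionRing (CurveRing q),
      algebraMap (CurveRing q) (FractionRing (CurveRing q)) f =
        algebraMap (CurveRing q) (FractionRing (CurveRing q)) g * w ^ 2)
    (r : ℕ) (b : Fin r → CurveRing q) (hb0 : ∀ i, b i ≠ 0)
    (hgsos : g = ∑ i, b i ^ 2) :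
    (∃ a : Fin r → CurveRing q, f = ∑ i, a i ^ 2 ∧
      ∀ i, (2 * curveDelta q (a i) : ℤ) =
        2 * curveDelta q (b i) + (curveDelta q f : ℤ) - curveDelta q g) ∧
    2 * curveTheta q f + (curveDelta q g : ℕ∞) ≤
      2 * curveTheta q g + (curveDelta q f : ℕ∞) := by
  have hsq' : Squarefree q := fun p hp => (isUnit_map (algebraMap ℝ ℂ)).1
    (hsep _ (by simpa using Polynomial.map_dvd (algebraMap ℝ ℂ) hp))
  have hdom := curveRing_isDomain hmonic
  refine ⟨?_, ?_⟩
  · obtain ⟨a, hfa, ha⟩ :=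
      exists_sum_sq_transfer hmonic hdeg hsq' hf0 hg0 hgz
        (K := FractionRing (CurveRing q)) hsq b hgsos
    refine ⟨a, hfa, fun i => ?_⟩
    have := (ha i).2 (hb0 i)
    omega
  · rcases Set.eq_empty_or_nonempty {d : ℕ∞ | ∃ n : ℕ, d = (n : ℕ∞) ∧ IsSosLe q g n} with h | h
    · have hθ : curveTheta q g = ⊤ := by rw [curveTheta, h, sInf_empty]
      rw [hθ, ENat.mul_top two_ne_zero, top_add]
      exact le_top
    · obtain ⟨n, hn, s, c, hgc, hc⟩ := csInf_mem h
      change curveTheta q g = n at hn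
      obtain ⟨a, hfa, ha⟩ := exists_sum_sq_transfer hmonic hdeg hsq' hf0 hg0 hgz
        (K := FractionRing (CurveRing q)) hsq c hgc
      obtain ⟨j, hj⟩ : ∃ j, c j ≠ 0 := by
        by_contra! h0
        exact hg0 (by simp [hgc, h0])
      have haj := (ha j).2 hj
      have hcj := hc j
      obtain ⟨m, hm⟩ : ∃ m, m = n - curveDelta q (c j) + curveDelta q (a j) := ⟨_, rfl⟩
      have hfm : curveTheta q f ≤ m := by
        refine sInf_le ⟨m, rfl, s, a, hfa, fun i => ?_⟩
        by_cases hi : c i = 0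
        · rw [(ha i).1 hi, ← curveElem_zero]
          simp [curveDelta]
        · have h1 := (ha i).2 hi
          have h2 := hc i
          omega
      rw [hn]
      calc 2 * curveTheta q f + (curveDelta q g : ℕ∞)
          ≤ 2 * (m : ℕ∞) + (curveDelta q g : ℕ∞) := by gcongr
        _ = 2 * (n : ℕ∞) + (curveDelta q f : ℕ∞) := by
          norm_cast
          omega

end
end
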